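/- Suppose the real numbers r_1, …, r_n are chosen so that the hyperplane arrangement H is simple. Then the Ehrhart δ-polynomial of the Lawrence polytope P_B satisfies δ_B(t) = Σ_{F ∈ M_B} #(BOX(F) ∩ ℤ^d) · t^{dim F} · h^bd_F(t). -/

import Mathlib

open scoped BigOperators Pointwise
open Polynomial

noncomputable section

namespace LawrencePaper

attribute [local instance] Classical.propDecidable

/-- The real vector associated to an integer vector. -/
def toR (d : ℕ) (v : Fin d → ℤ) : Fin d → ℝ := fun j => (v j : ℝ)

/-- The `i`-th standard basis vector of `ℝ^n`. -/
def e (n : ℕ) (i : Fin n) : Fin n → ℝ := Pi.single i 1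

/-- The Lawrence polytope of the configuration `b`: the convex hull of the points
`(b i, e i)` and `(0, e i)`. -/
def lawrencePolytope (d n : ℕ) (b : Fin n → Fin d → ℤ) : Set ((Fin d → ℝ) × (Fin n → ℝ)) :=
  convexHull ℝ
    ((Set.range fun i => (toR d (b i), e n i)) ∪
      (Set.range fun i => ((0 : Fin d → ℝ), e n i)))

/-- The number of lattice points in the `m`-th dilate of `P`. -/
def latticeCount (d n : ℕ) (P : Set ((Fin d → ℝ) × (Fin n → ℝ))) (m : ℕ) : ℕ :=
  Nat.card {z : (Fin d → ℤ) × (Fin n → ℤ) |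
    (toR d z.1, fun j => (z.2 j : ℝ)) ∈ (m : ℝ) • P}

/-- `δ` is the Ehrhart δ-polynomial of the `(d+n-1)`-dimensional polytope `P ⊆ ℝ^{d+n}`:
it has degree at most `n+d-1` and satisfies
`(1-t)^{n+d} * Σ_{m ≥ 0} f_P(m) t^m = δ(t)` as formal power series. -/
def IsDeltaPoly (d n : ℕ) (P : Set ((Fin d → ℝ) × (Fin n → ℝ))) (δ : Polynomial ℤ) : Prop :=
  δ.natDegree ≤ n + d - 1 ∧
    (1 - PowerSeries.X) ^ (n + d) *
      PowerSeries.mk (fun m => (latticeCount d n P m : ℤ)) = (δ : PowerSeries ℤ)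

/-- Membership in the matroid `M_B`: the index set `F` corresponds to a linearly
independent subset of the configuration. -/
def memMatroid (d n : ℕ) (b : Fin n → Fin d → ℤ) (F : Finset (Fin n)) : Prop :=
  LinearIndependent ℝ (fun i : F => toR d (b i.1))

/-- The linear span of the vectors indexed by `F`. -/
def spanF (d n : ℕ) (b : Fin n → Fin d → ℤ) (F : Finset (Fin n)) : Submodule ℝ (Fin d → ℝ) :=
  Submodule.span ℝ ((fun i => toR d (b i)) '' F)

/-- The dimension of an element `F` of the matroid: the dimension of its span. -/
def dimF (d n : ℕ) (b : Fin n → Fin d → ℤ) (F : Finset (Fin n)) : ℕ :=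
  Module.finrank ℝ (spanF d n b F)

/-- `BOX(F) = { Σ_{i ∈ F} α_i b_i  :  0 < α_i < 1 }`; `BOX(∅) = {0}`. -/
def box (d n : ℕ) (b : Fin n → Fin d → ℤ) (F : Finset (Fin n)) : Set (Fin d → ℝ) :=
  {x | ∃ α : Fin n → ℝ, (∀ i ∈ F, 0 < α i ∧ α i < 1) ∧ x = ∑ i ∈ F, α i • toR d (b i)}

/-- The number of lattice points in `BOX(F)`. -/
def boxCount (d n : ℕ) (b : Fin n → Fin d → ℤ) (F : Finset (Fin n)) : ℕ :=
  Nat.card {z : Fin d → ℤ | toR d z ∈ box d n b F}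

/-- Membership in the restricted matroid `M_F`: the index set `G` corresponds to a linearly
independent subset of the induced configuration `B_F` in `ℝ^d / Span F`. -/
def memMatroidRes (d n : ℕ) (b : Fin n → Fin d → ℤ) (F G : Finset (Fin n)) : Prop :=
  (∀ i ∈ G, toR d (b i) ∉ spanF d n b F) ∧
    LinearIndependent ℝ (fun i : G => (spanF d n b F).mkQ (toR d (b i.1)))

/-- The dimension of an element `G` of the restricted matroid `M_F`: the dimension of the
span of the corresponding vectors in `ℝ^d / Span F`. -/
def dimRes (d n : ℕ) (b : Fin n → Fin d → ℤ) (F G : Finset (Fin n)) : ℕ :=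
  Module.finrank ℝ (Submodule.span ℝ ((fun i => (spanF d n b F).mkQ (toR d (b i))) '' G))

/-- `f_i`: the number of elements of the restricted matroid `M_F` of dimension `i`. -/
def fRes (d n : ℕ) (b : Fin n → Fin d → ℤ) (F : Finset (Fin n)) (i : ℕ) : ℕ :=
  Nat.card {G : Finset (Fin n) | memMatroidRes d n b F G ∧ dimRes d n b F G = i}

/-- The `h`-polynomial `h_F(t) = Σ_{i=0}^{codim F} f_i t^i (1-t)^{codim F - i}` of `M_F`. -/
def hPoly (d n : ℕ) (b : Fin n → Fin d → ℤ) (F : Finset (Fin n)) : Polynomial ℤ :=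
  ∑ i ∈ Finset.range (d - dimF d n b F + 1),
    C (fRes d n b F i : ℤ) * X ^ i * (1 - X) ^ (d - dimF d n b F - i)

/-- The hyperplane `H_i = {u : ⟨u, b_i⟩ = r_i}`. -/
def hyperplane (d n : ℕ) (b : Fin n → Fin d → ℤ) (r : Fin n → ℝ) (i : Fin n) :
    Set (Fin d → ℝ) :=
  {u | ∑ j, u j * (b i j : ℝ) = r i}

/-- The arrangement `H` is simple: the intersection of any `l` of the hyperplanes is
either empty or has codimension `l`. -/
def Simple (d n : ℕ) (b : Fin n → Fin d → ℤ) (r : Fin n → ℝ) : Prop :=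
  ∀ s : Finset (Fin n), (⋂ i ∈ s, hyperplane d n b r i) = ∅ ∨
    ∀ x ∈ ⋂ i ∈ s, hyperplane d n b r i,
      Module.finrank ℝ
        (Submodule.span ℝ ((fun u => u - x) '' ⋂ i ∈ s, hyperplane d n b r i)) + s.card = d

/-- The affine subspace `A_F = ⋂_{i ∈ F} H_i`. -/
def flat (d n : ℕ) (b : Fin n → Fin d → ℤ) (r : Fin n → ℝ) (F : Finset (Fin n)) :
    Set (Fin d → ℝ) :=
  ⋂ i ∈ F, hyperplane d n b r i

/-- The cell of the restricted arrangement `H^F` containing the point `u ∈ A_F`: all points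
of `A_F` satisfying the same relations `<`, `=`, `>` as `u` with respect to each hyperplane
of `H^F`. -/
def cellOf (d n : ℕ) (b : Fin n → Fin d → ℤ) (r : Fin n → ℝ) (F : Finset (Fin n))
    (u : Fin d → ℝ) : Set (Fin d → ℝ) :=
  {v ∈ flat d n b r F | ∀ i : Fin n, toR d (b i) ∉ spanF d n b F →
    (((∑ j, v j * (b i j : ℝ)) < r i ↔ (∑ j, u j * (b i j : ℝ)) < r i) ∧
      ((∑ j, v j * (b i j : ℝ)) = r i ↔ (∑ j, u j * (b i j : ℝ)) = r i))}

/-- `f^bd_k`: the number of bounded cells of the restricted arrangement `H^F` of dimension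
`k` (the dimension of a cell being the dimension of its affine span). -/
def fBd (d n : ℕ) (b : Fin n → Fin d → ℤ) (r : Fin n → ℝ) (F : Finset (Fin n)) (k : ℕ) : ℕ :=
  Nat.card {Cs : Set (Fin d → ℝ) | (∃ u ∈ flat d n b r F, Cs = cellOf d n b r F u) ∧
    Bornology.IsBounded Cs ∧ Module.finrank ℝ (vectorSpan ℝ Cs) = k}

/-- `h^bd_F(t) = Σ_{i=0}^{codim F} f^bd_i (t-1)^i`. -/
def hBdPoly (d n : ℕ) (b : Fin n → Fin d → ℤ) (r : Fin n → ℝ) (F : Finset (Fin n)) :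
    Polynomial ℤ :=
  ∑ i ∈ Finset.range (d - dimF d n b F + 1), C (fBd d n b r F i : ℤ) * (X - 1) ^ i

/-- The complement within `A_F` of the union of the hyperplanes of `H^F`. -/
def arrComplement (d n : ℕ) (b : Fin n → Fin d → ℤ) (r : Fin n → ℝ) (F : Finset (Fin n)) :
    Set (Fin d → ℝ) :=
  flat d n b r F \ ⋃ i ∈ {i : Fin n | toR d (b i) ∉ spanF d n b F}, hyperplane d n b r i

/-- `R^bd_F`: the number of bounded regions (connected components of the complement within
`A_F` of the union of the hyperplanes) of the restricted arrangement `H^F`. -/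
def boundedRegionCount (d n : ℕ) (b : Fin n → Fin d → ℤ) (r : Fin n → ℝ)
    (F : Finset (Fin n)) : ℕ :=
  Nat.card {R : Set (Fin d → ℝ) | (∃ x ∈ arrComplement d n b r F,
    R = connectedComponentIn (arrComplement d n b r F) x) ∧ Bornology.IsBounded R}

/-- `F` is a maximal linearly independent subset of the configuration. -/
def IsMaximalIndep (d n : ℕ) (b : Fin n → Fin d → ℤ) (F : Finset (Fin n)) : Prop :=
  memMatroid d n b F ∧ ∀ G : Finset (Fin n), memMatroid d n b G → F ⊆ G → F = G

/-- The matroid `M_B` is coloop free: no element of the configuration lies in every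
maximal linearly independent subset. -/
def ColoopFree (d n : ℕ) (b : Fin n → Fin d → ℤ) : Prop :=
  ∀ i : Fin n, ∃ F : Finset (Fin n), IsMaximalIndep d n b F ∧ i ∉ F

/-- `f_i`: the number of elements of the matroid `M_B` of dimension `i`. -/
def fMat (d n : ℕ) (b : Fin n → Fin d → ℤ) (i : ℕ) : ℕ :=
  Nat.card {F : Finset (Fin n) | memMatroid d n b F ∧ dimF d n b F = i}

section Proof

open Filter Topology Module

/-- **Farkas' lemma** for finitely many linear functionals on a real vector space. -/
theorem farkas {V ι : Type*} [AddCommGroup V] [Module ℝ V] (s : Finset ι) :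
    ∀ (a : ι → V →ₗ[ℝ] ℝ) (f : V →ₗ[ℝ] ℝ),
      (∀ x, (∀ i ∈ s, 0 ≤ a i x) → 0 ≤ f x) →
      ∃ c : ι → ℝ, (∀ i ∈ s, 0 ≤ c i) ∧ f = ∑ i ∈ s, c i • a i := by
  induction s using Finset.induction_on with
  | empty =>
    intro a f h
    refine ⟨0, by simp, ?_⟩
    ext x
    have h1 := h x (by simp)
    have h2 := h (-x) (by simp)
    simp only [map_neg] at h2
    simp only [Finset.sum_empty, LinearMap.zero_apply]
    linarith
  | insert j s hj ih =>
    intro a f h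
    by_cases hs : ∀ x, (∀ i ∈ s, 0 ≤ a i x) → 0 ≤ f x
    · obtain ⟨c, hc, hf⟩ := ih a f hs
      refine ⟨fun i => if i = j then 0 else c i, ?_, ?_⟩
      · intro i hi
        dsimp only
        split_ifs with hij
        · exact le_rfl
        · exact hc i ((Finset.mem_insert.1 hi).resolve_left hij)
      · rw [Finset.sum_insert hj, hf]
        simp only [if_true, zero_smul, zero_add]
        refine Finset.sum_congr rfl fun i hi => ?_
        rw [if_neg (by rintro rfl; exact hj hi)]
    · push Not at hs
      obtain ⟨x₁, hx₁, hfx₁⟩ := hs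
      have hjx₁ : a j x₁ < 0 := by
        by_contra! hcon
        refine absurd (h x₁ ?_) (not_le.2 hfx₁)
        intro i hi
        rcases Finset.mem_insert.1 hi with rfl | hi
        · exact hcon
        · exact hx₁ i hi
      set x₀ : V := (-(a j x₁))⁻¹ • x₁ with hx₀
      have hpos : 0 < (-(a j x₁))⁻¹ := inv_pos.2 (by linarith)
      have hax₀ : ∀ i ∈ s, 0 ≤ a i x₀ := fun i hi => by
        rw [hx₀, map_smul, smul_eq_mul]
        exact mul_nonneg hpos.le (hx₁ i hi)
      have hfx₀ : f x₀ < 0 := by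
        rw [hx₀, map_smul, smul_eq_mul]
        exact mul_neg_of_pos_of_neg hpos hfx₁
      have hjx₀ : a j x₀ = -1 := by
        rw [hx₀, map_smul, smul_eq_mul]
        have : a j x₁ ≠ 0 := hjx₁.ne
        field_simp
      obtain ⟨c, hc, hf⟩ := ih (fun i => a i + a i x₀ • a j) (f + f x₀ • a j) (by
        intro x hx
        have := h (x + a j x • x₀) (by
          intro i hi
          rcases Finset.mem_insert.1 hi with rfl | hi
          · simp [hjx₀]
          · have := hx i hi
            simp only [LinearMap.add_apply, LinearMap.smul_apply, smul_eq_mul] at this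
            simp only [map_add, map_smul, smul_eq_mul]
            linarith)
        simp only [map_add, map_smul, smul_eq_mul] at this
        simp only [LinearMap.add_apply, LinearMap.smul_apply, smul_eq_mul]
        linarith)
      refine ⟨fun i => if i = j then (∑ i ∈ s, c i * a i x₀) - f x₀ else c i, ?_, ?_⟩
      · intro i hi
        dsimp only
        split_ifs with hij
        · have : 0 ≤ ∑ i ∈ s, c i * a i x₀ :=
            Finset.sum_nonneg fun i hi => mul_nonneg (hc i hi) (hax₀ i hi)
          linarith
        · exact hc i ((Finset.mem_insert.1 hi).resolve_left hij)
      · rw [Finset.sum_insert hj]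
        simp only [if_true]
        have hsum : ∑ i ∈ s, (if i = j then (∑ i ∈ s, c i * a i x₀) - f x₀ else c i) • a i
            = ∑ i ∈ s, c i • a i := by
          refine Finset.sum_congr rfl fun i hi => ?_
          rw [if_neg (by rintro rfl; exact hj hi)]
        rw [hsum]
        ext x
        have := LinearMap.congr_fun hf x
        simp only [LinearMap.add_apply, LinearMap.smul_apply, smul_eq_mul, LinearMap.sum_apply,
          mul_add, Finset.sum_add_distrib] at this
        simp only [LinearMap.add_apply, LinearMap.smul_apply, smul_eq_mul, LinearMap.sum_apply,
          sub_mul, Finset.sum_mul]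
        have h2 : ∑ i ∈ s, c i * (a i x₀ * a j x) = ∑ i ∈ s, c i * a i x₀ * a j x :=
          Finset.sum_congr rfl fun i _ => by ring
        linarith

/-- The integer-valued indicator function of a set of reals. -/
def ind (X : Set ℝ) (t : ℝ) : ℤ := if t ∈ X then 1 else 0

/-- The indicator function of `X` drops by `η` immediately to the right of `p`, and has no
other such jump. -/
def HasJump (X : Set ℝ) (p : ℝ) (η : ℤ) : Prop :=
  ∀ t, ∀ᶠ ε in 𝓝[>] (0 : ℝ), ind X t - ind X (t + ε) = if t = p then η else 0

theorem hasJump_empty : HasJump ∅ 0 0 := fun t => by simp [ind]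

theorem eventually_add_lt {t b : ℝ} (h : t < b) : ∀ᶠ ε in 𝓝[>] (0 : ℝ), t + ε < b := by
  have : ∀ᶠ ε in 𝓝[>] (0 : ℝ), ε < b - t :=
    (eventually_lt_nhds (by linarith : (0 : ℝ) < b - t)).filter_mono nhdsWithin_le_nhds
  filter_upwards [this] with ε hε
  linarith

theorem hasJump_Icc {a b : ℝ} (hab : a ≤ b) : HasJump (Set.Icc a b) b 1 := by
  intro t
  have hpos : ∀ᶠ ε in 𝓝[>] (0 : ℝ), 0 < ε := self_mem_nhdsWithin
  rcases lt_or_ge t a with h1 | h1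
  · filter_upwards [hpos, eventually_add_lt h1] with ε h2 h3
    simp only [ind, Set.mem_Icc]
    rw [if_neg (by grind), if_neg (by grind), if_neg (by grind)]; rfl
  rcases lt_or_ge t b with h2 | h2
  · filter_upwards [hpos, eventually_add_lt h2] with ε h2 h3
    simp only [ind, Set.mem_Icc]
    rw [if_pos (by grind), if_pos (by grind), if_neg (by grind)]; rfl
  · filter_upwards [hpos] with ε h3
    simp only [ind, Set.mem_Icc]
    rcases h2.eq_or_lt with rfl | h2
    · rw [if_pos (by grind), if_neg (by grind), if_pos rfl]; rfl
    · rw [if_neg (by grind), if_neg (by grind), if_neg (by grind)]; rfl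

theorem hasJump_Ioo {a b : ℝ} (hab : a < b) : HasJump (Set.Ioo a b) a (-1) := by
  intro t
  have hpos : ∀ᶠ ε in 𝓝[>] (0 : ℝ), 0 < ε := self_mem_nhdsWithin
  rcases lt_or_ge t a with h1 | h1
  · filter_upwards [hpos, eventually_add_lt h1] with ε h2 h3
    simp only [ind, Set.mem_Ioo]
    rw [if_neg (by grind), if_neg (by grind), if_neg (by grind)]; rfl
  rcases lt_or_ge t b with h2 | h2
  · filter_upwards [hpos, eventually_add_lt h2] with ε h2 h3
    simp only [ind, Set.mem_Ioo]
    rcases h1.eq_or_lt with rfl | h1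
    · rw [if_neg (by grind), if_pos (by grind), if_pos rfl]; rfl
    · rw [if_pos (by grind), if_pos (by grind), if_neg (by grind)]; rfl
  · filter_upwards [hpos] with ε h3
    simp only [ind, Set.mem_Ioo]
    rw [if_neg (by grind), if_neg (by grind), if_neg (by grind)]; rfl

theorem exists_hasJump_of_isCompact {X : Set ℝ} (hX : IsCompact X) (hc : Convex ℝ X) :
    ∃ p, HasJump X p (if X.Nonempty then 1 else 0) := by
  rcases X.eq_empty_or_nonempty with rfl | hne
  · exact ⟨0, by simpa using hasJump_empty⟩
  · rw [if_pos hne]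
    have := eq_Icc_of_connected_compact ⟨hne, hc.isPreconnected⟩ hX
    refine ⟨sSup X, ?_⟩
    rw [this]
    have hle : sInf X ≤ sSup X := Real.sInf_le_sSup X hX.bddBelow hX.bddAbove
    rw [csSup_Icc hle]
    exact hasJump_Icc hle

theorem exists_hasJump_of_isOpen {X : Set ℝ} (hX : IsOpen X) (hc : Convex ℝ X)
    (hb : Bornology.IsBounded X) :
    ∃ p, HasJump X p (if X.Nonempty then -1 else 0) := by
  rcases X.eq_empty_or_nonempty with rfl | hne
  · exact ⟨0, by simpa using hasJump_empty⟩
  · rw [if_pos hne]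
    have hIoo : X = Set.Ioo (sInf X) (sSup X) := by
      refine Set.Subset.antisymm ?_
        (IsConnected.Ioo_csInf_csSup_subset ⟨hne, hc.isPreconnected⟩ hb.bddBelow hb.bddAbove)
      intro x hx
      obtain ⟨ε, hε, hball⟩ := Metric.isOpen_iff.1 hX x hx
      have h1 : x - ε / 2 ∈ X := hball (by
        rw [Metric.mem_ball, Real.dist_eq, abs_lt]; constructor <;> linarith)
      have h2 : x + ε / 2 ∈ X := hball (by
        rw [Metric.mem_ball, Real.dist_eq, abs_lt]; constructor <;> linarith)
      have h3 := csInf_le hb.bddBelow h1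
      have h4 := le_csSup hb.bddAbove h2
      constructor <;> linarith
    have hlt : sInf X < sSup X := by
      rw [hIoo] at hne
      exact Set.nonempty_Ioo.1 hne
    refine ⟨sInf X, ?_⟩
    rw [hIoo, csInf_Ioo hlt]
    exact hasJump_Ioo hlt

/-- An integer relation between indicator functions of sets of reals yields the same relation
between their jumps. -/
theorem sum_jump_eq {ι : Type*} (s : Finset ι) (X : ι → Set ℝ) (p : ι → ℝ) (η w : ι → ℤ)
    (Y : Set ℝ) (q : ℝ) (θ : ℤ) (hX : ∀ j ∈ s, HasJump (X j) (p j) (η j))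
    (hY : HasJump Y q θ) (h : ∀ t, ∑ j ∈ s, w j * ind (X j) t = ind Y t) :
    ∑ j ∈ s, w j * η j = θ := by
  set T : Finset ℝ := insert q (s.image p) with hT
  have h1 : ∀ᶠ ε in 𝓝[>] (0 : ℝ), ∀ t ∈ T, ∀ j ∈ s,
      ind (X j) t - ind (X j) (t + ε) = if t = p j then η j else 0 := by
    rw [Filter.eventually_all_finset]
    intro t _
    rw [Filter.eventually_all_finset]
    exact fun j hj => hX j hj t
  have h2 : ∀ᶠ ε in 𝓝[>] (0 : ℝ), ∀ t ∈ T,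
      ind Y t - ind Y (t + ε) = if t = q then θ else 0 := by
    rw [Filter.eventually_all_finset]
    exact fun t _ => hY t
  obtain ⟨ε, hε1, hε2⟩ := (h1.and h2).exists
  have h3 : ∑ t ∈ T, (ind Y t - ind Y (t + ε)) = θ := by
    rw [Finset.sum_congr rfl hε2, Finset.sum_ite_eq', if_pos (Finset.mem_insert_self _ _)]
  rw [← h3]
  have h4 : ∀ t ∈ T, ind Y t - ind Y (t + ε) = ∑ j ∈ s, w j * (if t = p j then η j else 0) := by
    intro t ht
    rw [← h t, ← h (t + ε), ← Finset.sum_sub_distrib]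
    refine Finset.sum_congr rfl fun j hj => ?_
    rw [← hε1 t ht j hj]
    ring
  rw [Finset.sum_congr rfl h4, Finset.sum_comm]
  refine Finset.sum_congr rfl fun j hj => ?_
  rw [← Finset.mul_sum, Finset.sum_ite_eq',
    if_pos (Finset.mem_insert_of_mem (Finset.mem_image_of_mem p hj))]

theorem finrank_inf_ker_add_one {E : Type*} [AddCommGroup E] [Module ℝ E] [FiniteDimensional ℝ E]
    (S : Submodule ℝ E) (l : E →ₗ[ℝ] ℝ) {v : E} (hv : v ∈ S) (hlv : l v ≠ 0) :
    finrank ℝ (S ⊓ LinearMap.ker l : Submodule ℝ E) + 1 = finrank ℝ S := by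
  have h := LinearMap.finrank_range_add_finrank_ker (l.domRestrict S)
  have hr : LinearMap.range (l.domRestrict S) = ⊤ := by
    rw [LinearMap.range_eq_top]
    intro y
    refine ⟨(y / l v) • ⟨v, hv⟩, ?_⟩
    rw [map_smul, LinearMap.domRestrict_apply, smul_eq_mul, div_mul_cancel₀ _ hlv]
  have hk : finrank ℝ (LinearMap.ker (l.domRestrict S))
      = finrank ℝ (S ⊓ LinearMap.ker l : Submodule ℝ E) := by
    rw [← Submodule.finrank_map_subtype_eq, LinearMap.ker_domRestrict]
    exact congrArg (fun T : Submodule ℝ E => finrank ℝ T)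
      (Submodule.map_comap_subtype S (LinearMap.ker l))
  rw [hr, finrank_top, finrank_self, hk] at h
  omega

section Slices

variable {E : Type*} [NormedAddCommGroup E] [NormedSpace ℝ E]

/-- The level set `{x | l x = t}` as an affine subspace. -/
def level (l : E →L[ℝ] ℝ) (t : ℝ) : AffineSubspace ℝ E where
  carrier := {x | l x = t}
  smul_vsub_vadd_mem' := by
    intro c p₁ p₂ p₃ h₁ h₂ h₃
    simp only [Set.mem_ofPred_eq, vsub_eq_sub, vadd_eq_add, map_add, map_smul, map_sub,
      smul_eq_mul] at *
    rw [h₁, h₂, h₃]; ring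

theorem mem_level {l : E →L[ℝ] ℝ} {t : ℝ} {x : E} : x ∈ level l t ↔ l x = t := Iff.rfl

theorem direction_level {l : E →L[ℝ] ℝ} {t : ℝ} {p : E} (hp : l p = t) :
    (level l t).direction = LinearMap.ker (l : E →ₗ[ℝ] ℝ) := by
  ext v
  rw [AffineSubspace.mem_direction_iff_eq_vsub_right (mem_level.2 hp)]
  simp only [LinearMap.mem_ker, ContinuousLinearMap.coe_coe]
  constructor
  · rintro ⟨q, hq, rfl⟩
    rw [vsub_eq_sub, map_sub, mem_level.1 hq, hp, sub_self]
  · intro hv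
    exact ⟨v + p, by rw [mem_level, map_add, hv, hp, zero_add], by simp⟩

theorem direction_inf_level {A : AffineSubspace ℝ E} {l : E →L[ℝ] ℝ} {t : ℝ} {p : E}
    (hA : p ∈ A) (hp : l p = t) :
    (A ⊓ level l t).direction = A.direction ⊓ LinearMap.ker (l : E →ₗ[ℝ] ℝ) := by
  rw [AffineSubspace.direction_inf_of_mem hA (mem_level.2 hp), direction_level hp]

theorem isOpen_image_of_not_le_ker {A : AffineSubspace ℝ E} {U : Set E} (hU : IsOpen U)
    {l : E →L[ℝ] ℝ} {v : E} (hv : v ∈ A.direction) (hlv : l v ≠ 0) :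
    IsOpen (l '' {x | x ∈ A ∧ x ∈ U}) := by
  rw [isOpen_iff_mem_nhds]
  rintro _ ⟨x, ⟨hxA, hxU⟩, rfl⟩
  have hcont : Continuous fun t : ℝ => x + ((t - l x) / l v) • v := by fun_prop
  have hmem : (fun t : ℝ => x + ((t - l x) / l v) • v) ⁻¹' U ∈ 𝓝 (l x) :=
    (hU.preimage hcont).mem_nhds (by simpa using hxU)
  filter_upwards [hmem] with t ht
  refine ⟨x + ((t - l x) / l v) • v, ⟨?_, ht⟩, ?_⟩
  · have := AffineSubspace.vadd_mem_of_mem_direction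
      (A.direction.smul_mem ((t - l x) / l v) hv) hxA
    rwa [vadd_eq_add, add_comm] at this
  · rw [map_add, map_smul, smul_eq_mul, div_mul_cancel₀ _ hlv]
    ring

theorem exists_hasJump_image {A : AffineSubspace ℝ E} {U : Set E} (hU : IsOpen U)
    (hc : Convex ℝ U) (hb : Bornology.IsBounded {x | x ∈ A ∧ x ∈ U}) (l : E →L[ℝ] ℝ)
    [FiniteDimensional ℝ E] :
    ∃ (p : ℝ) (η w : ℤ), HasJump (l '' {x | x ∈ A ∧ x ∈ U}) p η ∧
      (w * η = if {x | x ∈ A ∧ x ∈ U}.Nonempty then (-1) ^ finrank ℝ A.direction else 0) ∧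
      ∀ t, (if {x | x ∈ A ⊓ level l t ∧ x ∈ U}.Nonempty then
        (-1 : ℤ) ^ finrank ℝ (A ⊓ level l t).direction else 0)
          = w * ind (l '' {x | x ∈ A ∧ x ∈ U}) t := by
  set C : Set E := {x | x ∈ A ∧ x ∈ U} with hC
  have hslice : ∀ t, {x | x ∈ A ⊓ level l t ∧ x ∈ U}.Nonempty ↔ t ∈ l '' C := by
    intro t
    constructor
    · rintro ⟨x, hx, hxU⟩
      exact ⟨x, ⟨hx.1, hxU⟩, hx.2⟩
    · rintro ⟨x, hx, rfl⟩
      exact ⟨x, ⟨hx.1, rfl⟩, hx.2⟩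
  have hCc : Convex ℝ C := A.convex.inter hc
  by_cases hl : ∃ v ∈ A.direction, l v ≠ 0
  · obtain ⟨v, hv, hlv⟩ := hl
    obtain ⟨p, hp⟩ := exists_hasJump_of_isOpen (isOpen_image_of_not_le_ker hU hv hlv)
      (hCc.linear_image (l : E →ₗ[ℝ] ℝ)) (l.lipschitz.isBounded_image hb)
    refine ⟨p, _, -(-1) ^ finrank ℝ A.direction, hp, ?_, ?_⟩
    · rw [Set.image_nonempty]
      split_ifs <;> simp
    · intro t
      rw [ind]
      simp only [hslice t]
      by_cases ht : t ∈ l '' C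
      · rw [if_pos ht, if_pos ht]
        obtain ⟨x, hx, hxt⟩ := ht
        rw [direction_inf_level hx.1 hxt,
          ← finrank_inf_ker_add_one A.direction (l : E →ₗ[ℝ] ℝ) hv hlv]
        ring
      · rw [if_neg ht, if_neg ht, mul_zero]
  · push Not at hl
    have hker : A.direction ⊓ LinearMap.ker (l : E →ₗ[ℝ] ℝ) = A.direction :=
      inf_eq_left.2 fun v hv => hl v hv
    have hsub : (l '' C).Subsingleton := by
      rintro _ ⟨x, hx, rfl⟩ _ ⟨y, hy, rfl⟩
      have := hl _ (A.vsub_mem_direction hx.1 hy.1)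
      rw [vsub_eq_sub, map_sub] at this
      linarith
    obtain ⟨p, hp⟩ := exists_hasJump_of_isCompact hsub.finite.isCompact
      (hCc.linear_image (l : E →ₗ[ℝ] ℝ))
    refine ⟨p, _, (-1) ^ finrank ℝ A.direction, hp, ?_, ?_⟩
    · rw [Set.image_nonempty]
      split_ifs <;> simp
    · intro t
      rw [ind]
      simp only [hslice t]
      by_cases ht : t ∈ l '' C
      · rw [if_pos ht, if_pos ht]
        obtain ⟨x, hx, hxt⟩ := ht
        rw [direction_inf_level hx.1 hxt, hker, mul_one]
      · rw [if_neg ht, if_neg ht, mul_zero]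

/-- **Euler's relation**: if a compact convex set is partitioned into bounded relatively open
convex sets, then the alternating count of these sets by dimension is one. -/
theorem euler_relation_aux [FiniteDimensional ℝ E] {ι : Type*} (s : Finset ι) (U : ι → Set E)
    (hU : ∀ j ∈ s, IsOpen (U j)) (hUc : ∀ j ∈ s, Convex ℝ (U j)) (k : ℕ) :
    ∀ (W : AffineSubspace ℝ E) (A : ι → AffineSubspace ℝ E) (D : Set E),
      finrank ℝ W.direction = k → (∀ j ∈ s, A j ≤ W) → D ⊆ W →
      (∀ j ∈ s, Bornology.IsBounded {x | x ∈ A j ∧ x ∈ U j}) →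
      IsCompact D → Convex ℝ D →
      (∀ x, ∑ j ∈ s, (if x ∈ A j ∧ x ∈ U j then (1 : ℤ) else 0) = if x ∈ D then 1 else 0) →
      ∑ j ∈ s, (if {x | x ∈ A j ∧ x ∈ U j}.Nonempty then
        (-1 : ℤ) ^ finrank ℝ (A j).direction else 0) = if D.Nonempty then 1 else 0 := by
  induction k with
  | zero =>
    intro W A D hW hAW hDW _ _ _ hsum
    by_cases hWne : ∃ q, q ∈ W
    · obtain ⟨q, hq⟩ := hWne
      have hWq : ∀ x ∈ W, x = q := by
        intro x hx
        have h1 := W.vsub_mem_direction hx hq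
        rw [Submodule.finrank_eq_zero.1 hW, Submodule.mem_bot, vsub_eq_zero_iff_eq] at h1
        exact h1
      have hD : D.Nonempty ↔ q ∈ D :=
        ⟨fun ⟨x, hx⟩ => hWq x (hDW hx) ▸ hx, fun h => ⟨q, h⟩⟩
      simp only [hD]
      rw [← hsum q]
      refine Finset.sum_congr rfl fun j hj => ?_
      have hCj : {x | x ∈ A j ∧ x ∈ U j}.Nonempty ↔ q ∈ A j ∧ q ∈ U j :=
        ⟨fun ⟨x, hx⟩ => hWq x (hAW j hj hx.1) ▸ hx, fun h => ⟨q, h⟩⟩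
      have h0 : finrank ℝ (A j).direction = 0 := by
        have := Submodule.finrank_mono (AffineSubspace.direction_le (hAW j hj))
        omega
      simp only [hCj, h0, pow_zero]
    · push Not at hWne
      rw [if_neg (fun ⟨x, hx⟩ => hWne x (hDW hx))]
      refine Finset.sum_eq_zero fun j hj => ?_
      rw [if_neg (fun ⟨x, hx⟩ => hWne x (hAW j hj hx.1))]
  | succ k ih =>
    intro W A D hW hAW hDW hb hD hDc hsum
    have hWbot : W.direction ≠ ⊥ := by
      intro h
      rw [h, finrank_bot] at hW
      omega
    obtain ⟨v, hvW, hv0⟩ := Submodule.exists_mem_ne_zero_of_ne_bot hWbot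
    obtain ⟨l, hlv⟩ := SeparatingDual.exists_ne_zero (R := ℝ) hv0
    obtain ⟨w₀, hw₀⟩ : (W : Set E).Nonempty := by
      rw [AffineSubspace.nonempty_iff_ne_bot]
      rintro rfl
      exact hWbot (AffineSubspace.direction_bot _ _ _)
    have hslice : ∀ t, ∑ j ∈ s, (if {x | x ∈ A j ⊓ level l t ∧ x ∈ U j}.Nonempty then
        (-1 : ℤ) ^ finrank ℝ (A j ⊓ level l t).direction else 0) = ind (l '' D) t := by
      intro t
      rw [ih (W ⊓ level l t) (fun j => A j ⊓ level l t) (D ∩ {x | l x = t})]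
      · have : (D ∩ {x | l x = t}).Nonempty ↔ t ∈ l '' D := Iff.rfl
        simp only [this, ind]
      · have hmem : w₀ + ((t - l w₀) / l v) • v ∈ W := by
          have := AffineSubspace.vadd_mem_of_mem_direction
            (W.direction.smul_mem ((t - l w₀) / l v) hvW) hw₀
          rwa [vadd_eq_add, add_comm] at this
        rw [direction_inf_level hmem (by
          rw [map_add, map_smul, smul_eq_mul, div_mul_cancel₀ _ hlv]; ring)]
        have := finrank_inf_ker_add_one W.direction (l : E →ₗ[ℝ] ℝ) hvW hlv
        omega
      · exact fun j hj => inf_le_inf_right _ (hAW j hj)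
      · exact fun x hx => ⟨hDW hx.1, hx.2⟩
      · exact fun j hj => (hb j hj).subset fun x hx => ⟨hx.1.1, hx.2⟩
      · exact hD.inter_right (isClosed_eq l.continuous continuous_const)
      · exact hDc.inter (level l t).convex
      · intro x
        by_cases hx : l x = t
        · have h1 : ∀ j, (x ∈ A j ⊓ level l t ∧ x ∈ U j) ↔ (x ∈ A j ∧ x ∈ U j) :=
            fun j => ⟨fun h => ⟨h.1.1, h.2⟩, fun h => ⟨⟨h.1, hx⟩, h.2⟩⟩
          have h2 : x ∈ D ∩ {x | l x = t} ↔ x ∈ D := ⟨fun h => h.1, fun h => ⟨h, hx⟩⟩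
          simp only [h1, h2]
          exact hsum x
        · rw [if_neg (fun h => hx h.2)]
          exact Finset.sum_eq_zero fun j _ => if_neg (fun h => hx h.1.2)
    have hjump : ∀ j : ι, ∃ (p : ℝ) (η w : ℤ), j ∈ s →
        HasJump (l '' {x | x ∈ A j ∧ x ∈ U j}) p η ∧
        (w * η = if {x | x ∈ A j ∧ x ∈ U j}.Nonempty then
          (-1) ^ finrank ℝ (A j).direction else 0) ∧
        ∀ t, (if {x | x ∈ A j ⊓ level l t ∧ x ∈ U j}.Nonempty then
          (-1 : ℤ) ^ finrank ℝ (A j ⊓ level l t).direction else 0)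
            = w * ind (l '' {x | x ∈ A j ∧ x ∈ U j}) t := by
      intro j
      by_cases hj : j ∈ s
      · obtain ⟨p, η, w, h⟩ := exists_hasJump_image (hU j hj) (hUc j hj) (hb j hj) l
        exact ⟨p, η, w, fun _ => h⟩
      · exact ⟨0, 0, 0, fun h => absurd h hj⟩
    choose p η w hpw using hjump
    obtain ⟨q, hq⟩ := exists_hasJump_of_isCompact (hD.image l.continuous)
      (hDc.linear_image (l : E →ₗ[ℝ] ℝ))
    have := sum_jump_eq s (fun j => l '' {x | x ∈ A j ∧ x ∈ U j}) p η w (l '' D) q _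
      (fun j hj => (hpw j hj).1) hq (by
        intro t
        rw [← hslice t]
        exact Finset.sum_congr rfl fun j hj => ((hpw j hj).2.2 t).symm)
    rw [Set.image_nonempty] at this
    rw [← this]
    exact Finset.sum_congr rfl fun j hj => ((hpw j hj).2.1).symm

theorem euler_relation [FiniteDimensional ℝ E] {ι : Type*} (s : Finset ι)
    (A : ι → AffineSubspace ℝ E) (U : ι → Set E) (D : Set E)
    (hU : ∀ j ∈ s, IsOpen (U j)) (hUc : ∀ j ∈ s, Convex ℝ (U j)) (hD : IsCompact D)
    (hDc : Convex ℝ D) (hDne : D.Nonempty) (hsub : ∀ j ∈ s, ∀ x ∈ A j, x ∈ U j → x ∈ D)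
    (hpart : ∀ x ∈ D, ∃! j, j ∈ s ∧ x ∈ A j ∧ x ∈ U j) :
    ∑ j ∈ s, (if {x | x ∈ A j ∧ x ∈ U j}.Nonempty then
      (-1 : ℤ) ^ finrank ℝ (A j).direction else 0) = 1 := by
  rw [euler_relation_aux s U hU hUc _ ⊤ A D rfl (fun _ _ => le_top) (fun _ _ => trivial)
    (fun j hj => hD.isBounded.subset fun x hx => hsub j hj x hx.1 hx.2) hD hDc, if_pos hDne]
  intro x
  by_cases hx : x ∈ D
  · obtain ⟨j, ⟨hj, hxj⟩, huniq⟩ := hpart x hx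
    rw [if_pos hx, Finset.sum_eq_single j, if_pos hxj]
    · exact fun i hi hij => if_neg fun h => hij (huniq i ⟨hi, h⟩)
    · exact fun h => absurd hj h
  · rw [if_neg hx]
    exact Finset.sum_eq_zero fun j hj => if_neg fun h => hx (hsub j hj x h.1 h.2)

end Slices

section Arrangement

variable {E ι : Type*} [NormedAddCommGroup E] [NormedSpace ℝ E]

/-- The cell of the arrangement of the hyperplanes `φ i = r i` with the given sign vector. -/
def signCell (φ : ι → E →L[ℝ] ℝ) (r : ι → ℝ) (s : ι → SignType) : Set E :=
  {u | ∀ i, SignType.sign (φ i u - r i) = s i}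

/-- The intersection of the hyperplanes on which the sign vector vanishes. -/
def signFlat (φ : ι → E →L[ℝ] ℝ) (r : ι → ℝ) (s : ι → SignType) : AffineSubspace ℝ E where
  carrier := {u | ∀ i, s i = 0 → φ i u = r i}
  smul_vsub_vadd_mem' := by
    intro c p₁ p₂ p₃ h₁ h₂ h₃ i hi
    simp only [vsub_eq_sub, vadd_eq_add, map_add, map_smul, map_sub, smul_eq_mul]
    rw [h₁ i hi, h₂ i hi, h₃ i hi]; ring

/-- The open set cut out by the strict inequalities of a sign vector. -/
def signOpen (φ : ι → E →L[ℝ] ℝ) (r : ι → ℝ) (s : ι → SignType) : Set E :=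
  {u | ∀ i, s i ≠ 0 → SignType.sign (φ i u - r i) = s i}

variable {φ : ι → E →L[ℝ] ℝ} {r : ι → ℝ} {s : ι → SignType}

theorem mem_signFlat {u : E} : u ∈ signFlat φ r s ↔ ∀ i, s i = 0 → φ i u = r i := Iff.rfl

theorem mem_signCell_iff {u : E} :
    u ∈ signCell φ r s ↔ u ∈ signFlat φ r s ∧ u ∈ signOpen φ r s := by
  constructor
  · intro h
    refine ⟨fun i hi => ?_, fun i _ => h i⟩
    have := h i
    rw [hi, sign_eq_zero_iff, sub_eq_zero] at this
    exact this
  · rintro ⟨h1, h2⟩ i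
    by_cases hi : s i = 0
    · rw [hi, sign_eq_zero_iff, sub_eq_zero]
      exact h1 i hi
    · exact h2 i hi

theorem signOpen_eq_iInter : signOpen φ r s =
    ⋂ i, {u | s i ≠ 0 → SignType.sign (φ i u - r i) = s i} := by
  ext u; simp [signOpen]

theorem signOpen_condition (i : ι) :
    {u | s i ≠ 0 → SignType.sign (φ i u - r i) = s i} = Set.univ ∨
    {u | s i ≠ 0 → SignType.sign (φ i u - r i) = s i} = {u | r i < φ i u} ∨
    {u | s i ≠ 0 → SignType.sign (φ i u - r i) = s i} = {u | φ i u < r i} := by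
  rcases h : s i with _ | _ | _
  · left; ext; simp
  · right; right; ext u
    change (SignType.neg ≠ 0 → SignType.sign (φ i u - r i) = -1) ↔ _
    simp [sign_eq_neg_one_iff]
  · right; left; ext u
    change (SignType.pos ≠ 0 → SignType.sign (φ i u - r i) = 1) ↔ _
    simp [sign_eq_one_iff]

theorem isOpen_signOpen [Finite ι] : IsOpen (signOpen φ r s) := by
  rw [signOpen_eq_iInter]
  refine isOpen_iInter_of_finite fun i => ?_
  rcases signOpen_condition (φ := φ) (r := r) (s := s) i with h | h | h <;> rw [h]
  · exact isOpen_univ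
  · exact isOpen_lt continuous_const (φ i).continuous
  · exact isOpen_lt (φ i).continuous continuous_const

theorem convex_signOpen : Convex ℝ (signOpen φ r s) := by
  rw [signOpen_eq_iInter]
  refine convex_iInter fun i => ?_
  rcases signOpen_condition (φ := φ) (r := r) (s := s) i with h | h | h <;> rw [h]
  · exact convex_univ
  · exact convex_halfSpace_gt (φ i : E →ₗ[ℝ] ℝ).isLinear _
  · exact convex_halfSpace_lt (φ i : E →ₗ[ℝ] ℝ).isLinear _

theorem convex_signCell : Convex ℝ (signCell φ r s) := by
  have : signCell φ r s = (signFlat φ r s : Set E) ∩ signOpen φ r s := by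
    ext u; exact mem_signCell_iff
  rw [this]
  exact (signFlat φ r s).convex.inter convex_signOpen

variable [Fintype ι]

/-- The sum of the absolute values of the defining functions of the arrangement. -/
def gauge (φ : ι → E →L[ℝ] ℝ) (r : ι → ℝ) (u : E) : ℝ := ∑ i, |φ i u - r i|

/-- The linear functional agreeing with `gauge` up to a constant on a cell. -/
def signForm (φ : ι → E →L[ℝ] ℝ) (s : ι → SignType) : E →L[ℝ] ℝ := ∑ i, (s i : ℝ) • φ i

/-- The constant `∑ i, s i * r i`. -/
def signConst (r : ι → ℝ) (s : ι → SignType) : ℝ := ∑ i, (s i : ℝ) * r i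

theorem gauge_eq_of_mem {u : E} (hu : u ∈ signCell φ r s) :
    gauge φ r u = signForm φ s u - signConst r s := by
  simp only [gauge, signForm, signConst, sum_apply, smul_apply, smul_eq_mul]
  rw [← Finset.sum_sub_distrib]
  refine Finset.sum_congr rfl fun i _ => ?_
  rw [← sign_mul_self, hu i]
  ring

theorem continuous_gauge : Continuous (gauge φ r) := by
  unfold gauge
  fun_prop

theorem convexOn_gauge : ConvexOn ℝ Set.univ (gauge φ r) := by
  refine ⟨convex_univ, fun x _ y _ a b ha hb hab => ?_⟩
  simp only [gauge, smul_eq_mul, Finset.mul_sum, ← Finset.sum_add_distrib]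
  refine Finset.sum_le_sum fun i _ => ?_
  have : φ i (a • x + b • y) - r i = a * (φ i x - r i) + b * (φ i y - r i) := by
    simp only [map_add, map_smul, smul_eq_mul]
    have : r i = (a + b) * r i := by rw [hab, one_mul]
    linarith
  rw [this]
  refine (abs_add_le _ _).trans ?_
  rw [abs_mul, abs_mul, abs_of_nonneg ha, abs_of_nonneg hb]

theorem isBounded_gauge_le [FiniteDimensional ℝ E] (hφ : ∀ v, (∀ i, φ i v = 0) → v = 0) (R : ℝ) :
    Bornology.IsBounded {u | gauge φ r u ≤ R} := by
  set T : E →ₗ[ℝ] (ι → ℝ) := LinearMap.pi fun i => (φ i : E →ₗ[ℝ] ℝ) with hT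
  have hinj : LinearMap.ker T = ⊥ := by
    rw [LinearMap.ker_eq_bot']
    intro v hv
    exact hφ v fun i => congrFun hv i
  obtain ⟨K, -, hK⟩ := T.exists_antilipschitzWith hinj
  refine (hK.isBounded_preimage (Metric.isBounded_closedBall (x := r) (r := R))).subset ?_
  intro u hu
  have hR : 0 ≤ R := (Finset.sum_nonneg fun i _ => abs_nonneg _).trans hu
  rw [Set.mem_preimage, Metric.mem_closedBall, dist_pi_le_iff hR]
  intro i
  rw [Real.dist_eq]
  refine le_trans ?_ hu
  exact Finset.single_le_sum (f := fun i => |φ i u - r i|) (fun i _ => abs_nonneg _)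
    (Finset.mem_univ i)

/-- The truncated cell, in relatively open form. -/
def truncFlat (φ : ι → E →L[ℝ] ℝ) (r : ι → ℝ) (R : ℝ) (j : (ι → SignType) × Bool) :
    AffineSubspace ℝ E :=
  if j.2 then signFlat φ r j.1
  else signFlat φ r j.1 ⊓ level (signForm φ j.1) (R + signConst r j.1)

/-- The open set whose intersection with `truncFlat` is the truncated cell. -/
def truncOpen (φ : ι → E →L[ℝ] ℝ) (r : ι → ℝ) (R : ℝ) (j : (ι → SignType) × Bool) : Set E :=
  if j.2 then signOpen φ r j.1 ∩ {u | signForm φ j.1 u < R + signConst r j.1}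
  else signOpen φ r j.1

theorem mem_trunc_iff {R : ℝ} {j : (ι → SignType) × Bool} {u : E} :
    u ∈ truncFlat φ r R j ∧ u ∈ truncOpen φ r R j ↔
      u ∈ signCell φ r j.1 ∧ if j.2 then gauge φ r u < R else gauge φ r u = R := by
  obtain ⟨s, _ | _⟩ := j
  · simp only [truncFlat, truncOpen, Bool.false_eq_true, if_false]
    constructor
    · rintro ⟨⟨h1, h2⟩, h3⟩
      have h := mem_signCell_iff.2 ⟨h1, h3⟩
      have h2 : signForm φ s u = R + signConst r s := h2
      refine ⟨h, ?_⟩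
      rw [gauge_eq_of_mem h, h2]; ring
    · rintro ⟨h1, h2⟩
      rw [gauge_eq_of_mem h1] at h2
      obtain ⟨h3, h4⟩ := mem_signCell_iff.1 h1
      exact ⟨⟨h3, by change signForm φ s u = _; linarith⟩, h4⟩
  · simp only [truncFlat, truncOpen, if_true]
    constructor
    · rintro ⟨h1, h2, h3⟩
      have h := mem_signCell_iff.2 ⟨h1, h2⟩
      have h3 : signForm φ s u < R + signConst r s := h3
      refine ⟨h, ?_⟩
      rw [gauge_eq_of_mem h]; linarith
    · rintro ⟨h1, h2⟩
      rw [gauge_eq_of_mem h1] at h2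
      obtain ⟨h3, h4⟩ := mem_signCell_iff.1 h1
      exact ⟨h3, h4, by change signForm φ s u < _; linarith⟩

/-- The contribution of a truncated cell to Euler's relation. -/
theorem eventually_trunc_contribution [FiniteDimensional ℝ E]
    (hφ : ∀ v, (∀ i, φ i v = 0) → v = 0) (hs : (signCell φ r s).Nonempty) :
    ∀ᶠ R in atTop, ∑ c : Bool,
      (if {x | x ∈ truncFlat φ r R (s, c) ∧ x ∈ truncOpen φ r R (s, c)}.Nonempty then
        (-1 : ℤ) ^ finrank ℝ (truncFlat φ r R (s, c)).direction else 0) =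
      if Bornology.IsBounded (signCell φ r s) then
        (-1 : ℤ) ^ finrank ℝ (signFlat φ r s).direction else 0 := by
  simp only [mem_trunc_iff, Fintype.sum_bool, if_true, Bool.false_eq_true, if_false]
  have htrue : ∀ R, truncFlat φ r R (s, true) = signFlat φ r s := fun R => by simp [truncFlat]
  obtain ⟨u₁, hu₁⟩ := hs
  by_cases hb : Bornology.IsBounded (signCell φ r s)
  · obtain ⟨B, hB⟩ := ((signForm φ s).lipschitz.isBounded_image hb).bddAbove
    filter_upwards [eventually_gt_atTop (B - signConst r s)] with R hR
    have hlt : ∀ u ∈ signCell φ r s, gauge φ r u < R := by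
      intro u hu
      rw [gauge_eq_of_mem hu]
      have := hB (Set.mem_image_of_mem _ hu)
      linarith
    rw [if_pos ⟨u₁, hu₁, hlt u₁ hu₁⟩, if_neg, if_pos hb, add_zero, htrue]
    rintro ⟨u, hu, hg⟩
    exact (hlt u hu).ne hg
  · filter_upwards [eventually_gt_atTop (gauge φ r u₁)] with R hR
    obtain ⟨u₂, hu₂, hu₂R⟩ : ∃ u₂ ∈ signCell φ r s, R < gauge φ r u₂ := by
      by_contra! h
      exact hb ((isBounded_gauge_le hφ R).subset h)
    have hconv : ((signForm φ s) '' signCell φ r s).OrdConnected :=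
      (convex_signCell.linear_image (signForm φ s : E →ₗ[ℝ] ℝ)).ordConnected
    have g1 := gauge_eq_of_mem hu₁
    have g2 := gauge_eq_of_mem hu₂
    obtain ⟨u₃, hu₃, hu₃R⟩ : R + signConst r s ∈ (signForm φ s) '' signCell φ r s :=
      hconv.out (Set.mem_image_of_mem _ hu₁) (Set.mem_image_of_mem _ hu₂)
        ⟨by linarith, by linarith⟩
    have g3 := gauge_eq_of_mem hu₃
    have hdir : finrank ℝ (truncFlat φ r R (s, false)).direction + 1 =
        finrank ℝ (signFlat φ r s).direction := by
      have h3 := (mem_signCell_iff.1 hu₃).1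
      have : truncFlat φ r R (s, false) =
          signFlat φ r s ⊓ level (signForm φ s) (R + signConst r s) := by simp [truncFlat]
      rw [this, direction_inf_level h3 hu₃R]
      refine finrank_inf_ker_add_one _ _
        (AffineSubspace.vsub_mem_direction h3 (mem_signCell_iff.1 hu₁).1) ?_
      rw [vsub_eq_sub, map_sub, ContinuousLinearMap.coe_coe, hu₃R]
      intro h
      linarith
    rw [if_pos ⟨u₁, hu₁, hR⟩, if_pos ⟨u₃, hu₃, by linarith⟩, if_neg hb, htrue, ← hdir]
    ring

/-- The Euler characteristic of the bounded complex of a closed convex union of cells of an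
essential hyperplane arrangement is one. -/
theorem sum_bounded_cells [DecidableEq ι] [FiniteDimensional ℝ E]
    (hφ : ∀ v, (∀ i, φ i v = 0) → v = 0)
    {D : Set E} (hDclosed : IsClosed D) (hDconv : Convex ℝ D) (hDne : D.Nonempty)
    (hD : ∀ s, (signCell φ r s ∩ D).Nonempty → signCell φ r s ⊆ D) :
    ∑ s : ι → SignType, (if (signCell φ r s ∩ D).Nonempty ∧ Bornology.IsBounded (signCell φ r s)
      then (-1 : ℤ) ^ finrank ℝ (signFlat φ r s).direction else 0) = 1 := by
  set S : Finset (ι → SignType) :=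
    Finset.univ.filter fun s => (signCell φ r s ∩ D).Nonempty with hS
  have hev : ∀ᶠ R in atTop, ∀ s ∈ S, ∑ c : Bool,
      (if {x | x ∈ truncFlat φ r R (s, c) ∧ x ∈ truncOpen φ r R (s, c)}.Nonempty then
        (-1 : ℤ) ^ finrank ℝ (truncFlat φ r R (s, c)).direction else 0) =
      if Bornology.IsBounded (signCell φ r s) then
        (-1 : ℤ) ^ finrank ℝ (signFlat φ r s).direction else 0 := by
    rw [Filter.eventually_all_finset]
    intro s hs
    exact eventually_trunc_contribution hφ (Finset.mem_filter.1 hs).2.left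
  obtain ⟨u₀, hu₀⟩ := hDne
  obtain ⟨R, hR, hu₀R⟩ := (hev.and (eventually_ge_atTop (gauge φ r u₀))).exists
  have hcl : IsClosed {u | gauge φ r u ≤ R} := isClosed_le continuous_gauge continuous_const
  have hcomp : IsCompact (D ∩ {u | gauge φ r u ≤ R}) :=
    Metric.isCompact_of_isClosed_isBounded (hDclosed.inter hcl)
      ((isBounded_gauge_le hφ R).subset Set.inter_subset_right)
  have hconv : Convex ℝ (D ∩ {u | gauge φ r u ≤ R}) := by
    have := (convexOn_gauge (φ := φ) (r := r)).convex_le R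
    simp only [Set.mem_univ, true_and] at this
    exact hDconv.inter this
  have key := euler_relation (S ×ˢ (Finset.univ : Finset Bool)) (truncFlat φ r R)
    (truncOpen φ r R) (D ∩ {u | gauge φ r u ≤ R}) ?_ ?_ hcomp hconv ⟨u₀, hu₀, hu₀R⟩ ?_ ?_
  · rw [Finset.sum_product, Finset.sum_congr rfl hR, hS, Finset.sum_filter] at key
    refine Eq.trans (Finset.sum_congr rfl fun s _ => ?_) key
    by_cases h : (signCell φ r s ∩ D).Nonempty <;> simp [h]
  · rintro ⟨s, _ | _⟩ -
    · simp only [truncOpen, Bool.false_eq_true, if_false]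
      exact isOpen_signOpen
    · simp only [truncOpen, if_true]
      exact isOpen_signOpen.inter (isOpen_lt (signForm φ s).continuous continuous_const)
  · rintro ⟨s, _ | _⟩ -
    · simp only [truncOpen, Bool.false_eq_true, if_false]
      exact convex_signOpen
    · simp only [truncOpen, if_true]
      exact convex_signOpen.inter
        (convex_halfSpace_lt (signForm φ s : E →ₗ[ℝ] ℝ).isLinear _)
  · rintro ⟨s, c⟩ hj x hx1 hx2
    obtain ⟨h1, h2⟩ := mem_trunc_iff.1 ⟨hx1, hx2⟩
    refine ⟨hD s (Finset.mem_filter.1 (Finset.mem_product.1 hj).1).2 h1, ?_⟩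
    cases c
    · simp only [Bool.false_eq_true, if_false] at h2
      exact h2.le
    · simp only [if_true] at h2
      exact h2.le
  · rintro x ⟨hxD, hxR⟩
    have hx : x ∈ signCell φ r fun i => SignType.sign (φ i x - r i) := fun i => rfl
    refine ⟨(fun i => SignType.sign (φ i x - r i), decide (gauge φ r x < R)), ⟨?_, ?_⟩, ?_⟩
    · exact Finset.mem_product.2
        ⟨Finset.mem_filter.2 ⟨Finset.mem_univ _, x, hx, hxD⟩, Finset.mem_univ _⟩
    · rw [mem_trunc_iff]
      refine ⟨hx, ?_⟩
      by_cases h : gauge φ r x < R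
      · simp [h]
      · simp only [h, decide_false, Bool.false_eq_true, if_false]
        exact le_antisymm hxR (not_lt.1 h)
    · rintro ⟨s, c⟩ ⟨-, h⟩
      obtain ⟨h1, h2⟩ := mem_trunc_iff.1 h
      refine Prod.ext (funext fun i => (h1 i).symm) ?_
      cases c
      · simp only [Bool.false_eq_true, if_false] at h2
        simp [h2]
      · simp only [if_true] at h2
        simp [h2]

end Arrangement

section Duality

variable {d n : ℕ}

/-- The linear functional `u ↦ ⟨u, b i⟩`. -/
def form (b : Fin n → Fin d → ℤ) (i : Fin n) : (Fin d → ℝ) →L[ℝ] ℝ :=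
  ∑ j, (b i j : ℝ) • ContinuousLinearMap.proj j

theorem form_apply (b : Fin n → Fin d → ℤ) (i : Fin n) (u : Fin d → ℝ) :
    form b i u = ∑ j, u j * (b i j : ℝ) := by
  simp [form, mul_comm]

/-- The linear combination `∑ i, c i • b i`. -/
def comb (b : Fin n → Fin d → ℤ) : (Fin n → ℝ) →ₗ[ℝ] (Fin d → ℝ) :=
  ∑ i, (LinearMap.proj i : (Fin n → ℝ) →ₗ[ℝ] ℝ).smulRight (toR d (b i))

theorem comb_apply (b : Fin n → Fin d → ℤ) (c : Fin n → ℝ) :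
    comb b c = ∑ i, c i • toR d (b i) := by
  simp [comb]

theorem comb_apply_apply (b : Fin n → Fin d → ℤ) (c : Fin n → ℝ) (j : Fin d) :
    comb b c j = ∑ i, c i * (b i j : ℝ) := by
  simp [comb_apply, toR]

theorem sum_mul_comb (b : Fin n → Fin d → ℤ) (c : Fin n → ℝ) (u : Fin d → ℝ) :
    ∑ i, c i * form b i u = ∑ j, u j * comb b c j := by
  simp only [form_apply, comb_apply_apply, Finset.mul_sum]
  rw [Finset.sum_comm]
  refine Finset.sum_congr rfl fun j _ => Finset.sum_congr rfl fun i _ => by ring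

theorem form_separates {b : Fin n → Fin d → ℤ} (hgen : Submodule.span ℤ (Set.range b) = ⊤)
    (v : Fin d → ℝ) (hv : ∀ i, form b i v = 0) : v = 0 := by
  have h : ∀ x : Fin d → ℤ, ∑ j, v j * (x j : ℝ) = 0 := by
    intro x
    have hx : x ∈ Submodule.span ℤ (Set.range b) := hgen ▸ Submodule.mem_top
    induction hx using Submodule.span_induction with
    | mem x hx =>
      obtain ⟨i, rfl⟩ := hx
      rw [← form_apply]; exact hv i
    | zero => simp
    | add x y _ _ hx hy =>
      simp only [Pi.add_apply, Int.cast_add, mul_add, Finset.sum_add_distrib, hx, hy, add_zero]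
    | smul m x _ hx =>
      have h : ∀ j, v j * (((m • x) j : ℤ) : ℝ) = m * (v j * x j) := fun j => by
        rw [Pi.smul_apply, smul_eq_mul, Int.cast_mul]; ring
      simp only [h, ← Finset.mul_sum, hx, mul_zero]
  funext j
  have := h (Pi.single j 1)
  simpa [Pi.single_apply] using this

/-- A dual optimal solution for the linear program minimising `∑ i, r i * c i` over the
coefficient vectors `0 ≤ c ≤ a` representing a given point. -/
theorem exists_dual_solution (b : Fin n → Fin d → ℤ) (r a c : Fin n → ℝ) (hc0 : ∀ i, 0 ≤ c i)
    (hca : ∀ i, c i ≤ a i)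
    (hmin : ∀ c' : Fin n → ℝ, (∀ i, 0 ≤ c' i) → (∀ i, c' i ≤ a i) → comb b c' = comb b c →
      ∑ i, r i * c i ≤ ∑ i, r i * c' i) :
    ∃ u : Fin d → ℝ, ∀ i,
      (c i < a i → form b i u - r i ≤ 0) ∧ (0 < c i → 0 ≤ form b i u - r i) := by
  set A : (Fin n ⊕ Fin n) ⊕ (Fin d ⊕ Fin d) → ((Fin n → ℝ) →ₗ[ℝ] ℝ) :=
    Sum.elim
      (Sum.elim (fun i => if c i = 0 then LinearMap.proj i else 0)
        (fun i => if c i = a i then -LinearMap.proj i else 0))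
      (Sum.elim (fun j => LinearMap.proj j ∘ₗ comb b) (fun j => -(LinearMap.proj j ∘ₗ comb b)))
    with hA
  set f : (Fin n → ℝ) →ₗ[ℝ] ℝ := ∑ i, r i • LinearMap.proj i with hf
  have hfx : ∀ x, f x = ∑ i, r i * x i := fun x => by simp [hf]
  have key : ∀ x, (∀ i ∈ Finset.univ, 0 ≤ A i x) → 0 ≤ f x := by
    intro x hx
    have h1 : ∀ i, c i = 0 → 0 ≤ x i := fun i hi => by
      have := hx (Sum.inl (Sum.inl i)) (Finset.mem_univ _)
      simpa [hA, hi] using this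
    have h2 : ∀ i, c i = a i → x i ≤ 0 := fun i hi => by
      have := hx (Sum.inl (Sum.inr i)) (Finset.mem_univ _)
      simpa [hA, hi] using this
    have h3 : comb b x = 0 := by
      funext j
      have e1 := hx (Sum.inr (Sum.inl j)) (Finset.mem_univ _)
      have e2 := hx (Sum.inr (Sum.inr j)) (Finset.mem_univ _)
      simp only [hA, Sum.elim_inr, Sum.elim_inl, LinearMap.comp_apply, LinearMap.proj_apply,
        LinearMap.neg_apply] at e1 e2
      exact le_antisymm (by simpa using e2) e1
    have hev : ∀ᶠ ε in 𝓝[>] (0 : ℝ), ∀ i, 0 ≤ c i + ε * x i ∧ c i + ε * x i ≤ a i := by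
      rw [Filter.eventually_all]
      intro i
      have hcont : Tendsto (fun ε : ℝ => c i + ε * x i) (𝓝[>] 0) (𝓝 (c i)) := by
        have : Continuous fun ε : ℝ => c i + ε * x i := by fun_prop
        have := (this.tendsto 0).mono_left (nhdsWithin_le_nhds (s := Set.Ioi 0))
        simpa using this
      refine Filter.Eventually.and ?_ ?_
      · rcases (hc0 i).eq_or_lt with h | h
        · filter_upwards [self_mem_nhdsWithin] with ε hε
          rw [← h, zero_add]
          exact mul_nonneg (le_of_lt hε) (h1 i h.symm)
        · filter_upwards [hcont.eventually (lt_mem_nhds h)] with ε hε using hε.le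
      · rcases (hca i).eq_or_lt with h | h
        · filter_upwards [self_mem_nhdsWithin] with ε hε
          have := mul_nonpos_of_nonneg_of_nonpos (le_of_lt hε) (h2 i h)
          linarith
        · filter_upwards [hcont.eventually (gt_mem_nhds h)] with ε hε using hε.le
    obtain ⟨ε, hε, hεpos⟩ := (hev.and self_mem_nhdsWithin).exists
    have := hmin (c + ε • x) (fun i => (hε i).1) (fun i => (hε i).2) (by
      rw [map_add, map_smul, h3, smul_zero, add_zero])
    simp only [Pi.add_apply, Pi.smul_apply, smul_eq_mul, mul_add, Finset.sum_add_distrib,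
      mul_left_comm _ ε, ← Finset.mul_sum] at this
    rw [hfx]
    have h4 : 0 ≤ ε * ∑ i, r i * x i := by linarith
    exact nonneg_of_mul_nonneg_right h4 hεpos
  obtain ⟨l, hl, hfl⟩ := farkas Finset.univ A f key
  refine ⟨fun j => l (Sum.inr (Sum.inl j)) - l (Sum.inr (Sum.inr j)), fun i => ?_⟩
  have h := congrArg (fun g : (Fin n → ℝ) →ₗ[ℝ] ℝ => g (Pi.single i 1)) hfl
  have hcomb : ∀ j, comb b (Pi.single i 1) j = b i j := fun j => by
    simp [comb_apply_apply, Pi.single_apply]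
  simp only [hfx, LinearMap.sum_apply, LinearMap.smul_apply, smul_eq_mul] at h
  simp only [Fintype.sum_sum_type, hA, Sum.elim_inl, Sum.elim_inr, LinearMap.neg_apply,
    LinearMap.comp_apply, LinearMap.proj_apply, hcomb] at h
  have t1 : ∑ k, r k * (Pi.single i 1 : Fin n → ℝ) k = r i := by simp [Pi.single_apply]
  have t2 : ∑ k, l (Sum.inl (Sum.inl k)) *
      (if c k = 0 then (LinearMap.proj k : (Fin n → ℝ) →ₗ[ℝ] ℝ) else 0) (Pi.single i 1) =
      if c i = 0 then l (Sum.inl (Sum.inl i)) else 0 := by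
    rw [Finset.sum_eq_single i]
    · split_ifs <;> simp
    · intro k _ hk
      split_ifs <;> simp [hk]
    · simp
  have t3 : ∑ k, l (Sum.inl (Sum.inr k)) *
      (if c k = a k then -(LinearMap.proj k : (Fin n → ℝ) →ₗ[ℝ] ℝ) else 0) (Pi.single i 1) =
      if c i = a i then -l (Sum.inl (Sum.inr i)) else 0 := by
    rw [Finset.sum_eq_single i]
    · split_ifs <;> simp
    · intro k _ hk
      split_ifs <;> simp [hk]
    · simp
  rw [t1, t2, t3] at h
  have hform : form b i (fun j => l (Sum.inr (Sum.inl j)) - l (Sum.inr (Sum.inr j))) - r i =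
      -(if c i = 0 then l (Sum.inl (Sum.inl i)) else 0) -
        if c i = a i then -l (Sum.inl (Sum.inr i)) else 0 := by
    rw [h, form_apply]
    simp only [sub_mul, Finset.sum_sub_distrib, mul_neg, Finset.sum_neg_distrib]
    ring
  have p1 := hl (Sum.inl (Sum.inl i)) (Finset.mem_univ _)
  have p2 := hl (Sum.inl (Sum.inr i)) (Finset.mem_univ _)
  rw [hform]
  refine ⟨fun hlt => ?_, fun hlt => ?_⟩
  · rw [if_neg hlt.ne]
    split_ifs <;> linarith
  · rw [if_neg hlt.ne']
    split_ifs <;> linarith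

/-- The zonotope of the points `∑ i, c i • b i` with `0 ≤ c ≤ a`. -/
def zonotope (b : Fin n → Fin d → ℤ) (a : Fin n → ℝ) : Set (Fin d → ℝ) :=
  {z | ∃ c : Fin n → ℝ, (∀ i, 0 ≤ c i ∧ c i ≤ a i) ∧ comb b c = z}

/-- The face of the coefficient box selected by a sign vector, mapped to a tile of the
zonotope. -/
def tile (b : Fin n → Fin d → ℤ) (s : Fin n → SignType) (a : Fin n → ℝ) : Set (Fin d → ℝ) :=
  {z | ∃ c : Fin n → ℝ, (∀ i, 0 ≤ c i ∧ c i ≤ a i) ∧ (∀ i, s i = -1 → c i = 0) ∧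
    (∀ i, s i = 1 → c i = a i) ∧ comb b c = z}

theorem tile_subset_zonotope (b : Fin n → Fin d → ℤ) (s : Fin n → SignType) (a : Fin n → ℝ) :
    tile b s a ⊆ zonotope b a := by
  rintro z ⟨c, hc, -, -, h⟩
  exact ⟨c, hc, h⟩

theorem exists_minimizer {b : Fin n → Fin d → ℤ} {a : Fin n → ℝ} {z : Fin d → ℝ} (r : Fin n → ℝ)
    (hz : z ∈ zonotope b a) :
    ∃ c : Fin n → ℝ, (∀ i, 0 ≤ c i) ∧ (∀ i, c i ≤ a i) ∧ comb b c = z ∧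
      ∀ c' : Fin n → ℝ, (∀ i, 0 ≤ c' i) → (∀ i, c' i ≤ a i) → comb b c' = comb b c →
        ∑ i, r i * c i ≤ ∑ i, r i * c' i := by
  have hcomp : IsCompact (Set.Icc (0 : Fin n → ℝ) a ∩ {c | comb b c = z}) :=
    isCompact_Icc.inter_right
      (isClosed_eq (comb b).continuous_of_finiteDimensional continuous_const)
  obtain ⟨c₀, hc₀, hc₀z⟩ := hz
  obtain ⟨c, ⟨⟨h0, ha⟩, hcz⟩, hc⟩ := hcomp.exists_isMinOn
    ⟨c₀, ⟨fun i => (hc₀ i).1, fun i => (hc₀ i).2⟩, hc₀z⟩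
    (f := fun c => ∑ i, r i * c i) (by fun_prop)
  refine ⟨c, h0, ha, hcz, fun c' h0' ha' hc' => ?_⟩
  exact hc ⟨⟨h0', ha'⟩, hc'.trans hcz⟩

/-- Every point of the zonotope is covered once, counted with signs, by the tiles of the
bounded cells. -/
theorem sum_tiles {b : Fin n → Fin d → ℤ} (hgen : Submodule.span ℤ (Set.range b) = ⊤)
    (r : Fin n → ℝ) {a : Fin n → ℝ} {z : Fin d → ℝ} (hz : z ∈ zonotope b a) :
    ∑ s : Fin n → SignType,
      (if (signCell (form b) r s).Nonempty ∧ Bornology.IsBounded (signCell (form b) r s) ∧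
          z ∈ tile b s a
        then (-1 : ℤ) ^ finrank ℝ (signFlat (form b) r s).direction else 0) = 1 := by
  obtain ⟨c, h0, ha, hcz, hmin⟩ := exists_minimizer r hz
  set D : Set (Fin d → ℝ) := ⋂ i, ({u | c i < a i → form b i u ≤ r i} ∩
    {u | 0 < c i → r i ≤ form b i u}) with hD
  have memD : ∀ u, u ∈ D ↔ ∀ i, (c i < a i → form b i u - r i ≤ 0) ∧
      (0 < c i → 0 ≤ form b i u - r i) := by
    intro u
    simp [hD, sub_nonneg]
  have hDne : D.Nonempty := by
    obtain ⟨u, hu⟩ := exists_dual_solution b r a c h0 ha hmin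
    exact ⟨u, (memD u).2 hu⟩
  have hDclosed : IsClosed D := by
    refine isClosed_iInter fun i => IsClosed.inter ?_ ?_
    · by_cases h : c i < a i
      · simpa [h] using isClosed_le (form b i).continuous continuous_const
      · simp [h]
    · by_cases h : 0 < c i
      · simpa [h] using isClosed_le continuous_const (form b i).continuous
      · simp [h]
  have hDconv : Convex ℝ D := by
    refine convex_iInter fun i => Convex.inter ?_ ?_
    · by_cases h : c i < a i
      · simpa [h] using convex_halfSpace_le (form b i : (Fin d → ℝ) →ₗ[ℝ] ℝ).isLinear (r i)
      · simpa [h] using convex_univ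
    · by_cases h : 0 < c i
      · simpa [h] using convex_halfSpace_ge (form b i : (Fin d → ℝ) →ₗ[ℝ] ℝ).isLinear (r i)
      · simpa [h] using convex_univ
  have htile : ∀ s, ∀ u ∈ signCell (form b) r s, (u ∈ D ↔ z ∈ tile b s a) := by
    intro s u hu
    rw [memD]
    constructor
    · intro h
      refine ⟨c, fun i => ⟨h0 i, ha i⟩, fun i hi => ?_, fun i hi => ?_, hcz⟩
      · have hs := hu i
        rw [hi, sign_eq_neg_one_iff] at hs
        by_contra hne
        exact absurd ((h i).2 (lt_of_le_of_ne (h0 i) (Ne.symm hne))) (not_le.2 hs)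
      · have hs := hu i
        rw [hi, sign_eq_one_iff] at hs
        by_contra hne
        exact absurd ((h i).1 (lt_of_le_of_ne (ha i) hne)) (not_le.2 hs)
    · rintro ⟨c', hc', hneg, hpos, hz'⟩
      have hle := hmin c' (fun i => (hc' i).1) (fun i => (hc' i).2) (hz'.trans hcz.symm)
      have hterm : ∀ i ∈ Finset.univ, (form b i u - r i) * (c i - c' i) ≤ 0 := by
        intro i _
        rcases lt_trichotomy (form b i u - r i) 0 with h | h | h
        · have : s i = -1 := by rw [← hu i, sign_eq_neg_one_iff]; exact h
          rw [hneg i this, sub_zero]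
          exact mul_nonpos_of_nonpos_of_nonneg h.le (h0 i)
        · rw [h, zero_mul]
        · have : s i = 1 := by rw [← hu i, sign_eq_one_iff]; exact h
          rw [hpos i this]
          exact mul_nonpos_of_nonneg_of_nonpos h.le (sub_nonpos.2 (ha i))
      have hsum : ∑ i, (form b i u - r i) * (c i - c' i) =
          ∑ i, r i * c' i - ∑ i, r i * c i := by
        have e1 := sum_mul_comb b c u
        have e2 := sum_mul_comb b c' u
        rw [hz', ← hcz, ← e1] at e2
        have : ∀ i, (form b i u - r i) * (c i - c' i) =
            c i * form b i u - c' i * form b i u + (r i * c' i - r i * c i) := fun i => by ring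
        simp only [this, Finset.sum_add_distrib, Finset.sum_sub_distrib, e2]
        ring
      have hzero : ∑ i, (form b i u - r i) * (c i - c' i) = 0 :=
        le_antisymm (Finset.sum_nonpos hterm) (by rw [hsum]; linarith)
      rw [Finset.sum_eq_zero_iff_of_nonpos hterm] at hzero
      intro i
      have hi := hzero i (Finset.mem_univ i)
      constructor
      · intro hlt
        by_contra! h
        have : s i = 1 := by rw [← hu i, sign_eq_one_iff]; exact h
        have h' := hpos i this
        rcases mul_eq_zero.1 hi with h1 | h1 <;> linarith
      · intro hlt
        by_contra! h
        have : s i = -1 := by rw [← hu i, sign_eq_neg_one_iff]; exact h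
        have h' := hneg i this
        rcases mul_eq_zero.1 hi with h1 | h1 <;> linarith
  have := sum_bounded_cells (φ := form b) (r := r) (form_separates hgen) hDclosed hDconv hDne (by
    rintro s ⟨u, hu, huD⟩ v hv
    exact (htile s v hv).2 ((htile s u hu).1 huD))
  refine Eq.trans (Finset.sum_congr rfl fun s _ => if_congr ?_ rfl rfl) this
  constructor
  · rintro ⟨⟨u, hu⟩, hb, ht⟩
    exact ⟨⟨u, hu, (htile s u hu).2 ht⟩, hb⟩
  · rintro ⟨⟨u, hu, huD⟩, hb⟩
    exact ⟨⟨u, hu⟩, hb, (htile s u hu).1 huD⟩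

end Duality

section SimpleArrangement

variable {d n : ℕ} {b : Fin n → Fin d → ℤ} {r : Fin n → ℝ}

theorem mem_flat {F : Finset (Fin n)} {u : Fin d → ℝ} :
    u ∈ flat d n b r F ↔ ∀ i ∈ F, form b i u = r i := by
  simp [flat, hyperplane, form_apply]

/-- The linear map recording the values of the forms indexed by `F`. -/
def formMap (b : Fin n → Fin d → ℤ) (F : Finset (Fin n)) : (Fin d → ℝ) →ₗ[ℝ] (F → ℝ) :=
  LinearMap.pi fun i => (form b i.1 : (Fin d → ℝ) →ₗ[ℝ] ℝ)

theorem span_sub_flat {F : Finset (Fin n)} {x : Fin d → ℝ} (hx : x ∈ flat d n b r F) :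
    Submodule.span ℝ ((fun u => u - x) '' flat d n b r F) = LinearMap.ker (formMap b F) := by
  have : (fun u => u - x) '' flat d n b r F = LinearMap.ker (formMap b F) := by
    ext v
    simp only [Set.mem_image, SetLike.mem_coe, LinearMap.mem_ker]
    constructor
    · rintro ⟨u, hu, rfl⟩
      funext i
      have h1 := mem_flat.1 hu i.1 i.2
      have h2 := mem_flat.1 hx i.1 i.2
      simp [formMap, h1, h2]
    · intro hv
      refine ⟨v + x, mem_flat.2 fun i hi => ?_, add_sub_cancel_right v x⟩
      have h1 : form b i v = 0 := congrFun hv ⟨i, hi⟩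
      rw [map_add, h1, zero_add, mem_flat.1 hx i hi]
  rw [this, Submodule.span_eq]

theorem finrank_ker_formMap (hr : Simple d n b r) {F : Finset (Fin n)}
    (hF : (flat d n b r F).Nonempty) :
    finrank ℝ (LinearMap.ker (formMap b F)) + F.card = d := by
  obtain ⟨x, hx⟩ := hF
  rcases hr F with h | h
  · have : x ∈ (∅ : Set (Fin d → ℝ)) := h ▸ hx
    exact absurd this (Set.notMem_empty x)
  · rw [← span_sub_flat hx]
    exact h x hx

theorem memMatroid_of_flat_nonempty (hr : Simple d n b r) {F : Finset (Fin n)}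
    (hF : (flat d n b r F).Nonempty) : memMatroid d n b F := by
  have hsurj : Function.Surjective (formMap b F) := by
    rw [← LinearMap.range_eq_top]
    apply Submodule.eq_top_of_finrank_eq
    have h1 := (formMap b F).finrank_range_add_finrank_ker
    have h2 := finrank_ker_formMap hr hF
    rw [finrank_fin_fun] at h1
    rw [finrank_fintype_fun_eq_card, Fintype.card_coe]
    omega
  unfold memMatroid
  rw [Fintype.linearIndependent_iff]
  intro g hg
  obtain ⟨u, hu⟩ := hsurj g
  have key : ∑ i, g i * g i = 0 := by
    have h1 : ∀ i : F, g i = form b i.1 u := fun i => (congrFun hu i).symm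
    calc ∑ i, g i * g i = ∑ i : F, g i * form b i.1 u := by
          refine Finset.sum_congr rfl fun i _ => by rw [← h1]
      _ = ∑ j, u j * (∑ i : F, g i • toR d (b i.1)) j := by
          simp only [form_apply, Finset.sum_apply, Pi.smul_apply, smul_eq_mul, toR,
            Finset.mul_sum]
          rw [Finset.sum_comm]
          refine Finset.sum_congr rfl fun j _ => Finset.sum_congr rfl fun i _ => by ring
      _ = 0 := by rw [hg]; simp
  intro i
  have := (Finset.sum_eq_zero_iff_of_nonneg fun i _ => mul_self_nonneg (g i)).1 key i
    (Finset.mem_univ i)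
  exact mul_self_eq_zero.1 this

theorem memMatroid_mono {F G : Finset (Fin n)} (hFG : F ⊆ G) (hG : memMatroid d n b G) :
    memMatroid d n b F := by
  have := hG.comp (fun i : F => (⟨i.1, hFG i.2⟩ : G)) fun i j h =>
    Subtype.ext (congrArg (fun k : G => k.1) h)
  exact this

theorem dimF_eq_card {F : Finset (Fin n)} (hF : memMatroid d n b F) : dimF d n b F = F.card := by
  have := finrank_span_eq_card hF
  rw [Fintype.card_coe] at this
  rw [← this, dimF, spanF, Set.image_eq_range]
  rfl

/-- The indices of the hyperplanes containing the cell with sign vector `s`. -/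
def zeroSet (s : Fin n → SignType) : Finset (Fin n) := Finset.univ.filter fun i => s i = 0

theorem mem_zeroSet {s : Fin n → SignType} {i : Fin n} : i ∈ zeroSet s ↔ s i = 0 := by
  simp [zeroSet]

theorem signCell_subset_flat (s : Fin n → SignType) :
    signCell (form b) r s ⊆ flat d n b r (zeroSet s) := by
  intro u hu
  refine mem_flat.2 fun i hi => ?_
  have := hu i
  rw [mem_zeroSet.1 hi, sign_eq_zero_iff, sub_eq_zero] at this
  exact this

theorem finrank_direction_signFlat (hr : Simple d n b r) {s : Fin n → SignType}
    (hs : (signCell (form b) r s).Nonempty) :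
    finrank ℝ (signFlat (form b) r s).direction + (zeroSet s).card = d := by
  have hne := hs.mono (signCell_subset_flat s)
  have hflat : (signFlat (form b) r s : Set (Fin d → ℝ)) = flat d n b r (zeroSet s) := by
    ext u
    rw [mem_flat, SetLike.mem_coe, mem_signFlat]
    simp only [mem_zeroSet]
  have hdim := finrank_ker_formMap hr hne
  obtain ⟨x, hx⟩ := hne
  have hdir : (signFlat (form b) r s).direction = LinearMap.ker (formMap b (zeroSet s)) := by
    rw [AffineSubspace.direction, hflat, vectorSpan_eq_span_vsub_set_right ℝ hx,
      ← span_sub_flat hx]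
    rfl
  rw [hdir]
  exact hdim

theorem memMatroid_zeroSet (hr : Simple d n b r) {s : Fin n → SignType}
    (hs : (signCell (form b) r s).Nonempty) : memMatroid d n b (zeroSet s) :=
  memMatroid_of_flat_nonempty hr (hs.mono (signCell_subset_flat s))

theorem vectorSpan_signCell {s : Fin n → SignType} (hs : (signCell (form b) r s).Nonempty) :
    vectorSpan ℝ (signCell (form b) r s) = (signFlat (form b) r s).direction := by
  obtain ⟨u, hu⟩ := hs
  obtain ⟨hu1, hu2⟩ := mem_signCell_iff.1 hu
  apply le_antisymm
  · exact vectorSpan_mono ℝ fun v hv => (mem_signCell_iff.1 hv).1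
  · intro v hv
    have hcont : Continuous fun ε : ℝ => ε • v + u := by fun_prop
    have hev : ∀ᶠ ε in 𝓝[>] (0 : ℝ), ε • v + u ∈ signOpen (form b) r s := by
      have h0 : (0 : ℝ) • v + u ∈ signOpen (form b) r s := by simpa using hu2
      exact ((hcont.tendsto 0).eventually (isOpen_signOpen.mem_nhds h0)).filter_mono
        nhdsWithin_le_nhds
    obtain ⟨ε, hε, hpos⟩ := (hev.and self_mem_nhdsWithin).exists
    have hmem : ε • v + u ∈ signCell (form b) r s :=
      mem_signCell_iff.2 ⟨AffineSubspace.vadd_mem_of_mem_direction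
        (Submodule.smul_mem _ ε hv) hu1, hε⟩
    have := vsub_mem_vectorSpan ℝ hmem hu
    rw [vsub_eq_sub, add_sub_cancel_right] at this
    exact (Submodule.smul_mem_iff _ (ne_of_gt hpos)).1 this

theorem form_eq_of_mem_span {F : Finset (Fin n)} {i : Fin n} (hi : toR d (b i) ∈ spanF d n b F)
    {u v : Fin d → ℝ} (hu : u ∈ flat d n b r F) (hv : v ∈ flat d n b r F) :
    form b i v = form b i u := by
  have h : ∀ x ∈ spanF d n b F, ∑ j, v j * x j = ∑ j, u j * x j := by
    intro x hx
    rw [spanF] at hx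
    induction hx using Submodule.span_induction with
    | mem x hx =>
      obtain ⟨k, hk, rfl⟩ := hx
      have h1 := mem_flat.1 hu k hk
      have h2 := mem_flat.1 hv k hk
      rw [form_apply] at h1 h2
      exact h2.trans h1.symm
    | zero => simp
    | add x y _ _ hx hy => simp only [Pi.add_apply, mul_add, Finset.sum_add_distrib, hx, hy]
    | smul c x _ hx =>
      simp only [Pi.smul_apply, smul_eq_mul, mul_left_comm _ c, ← Finset.mul_sum, hx]
  rw [form_apply, form_apply]
  exact h _ hi

/-- The sign vector of a point. -/
def signVec (b : Fin n → Fin d → ℤ) (r : Fin n → ℝ) (u : Fin d → ℝ) : Fin n → SignType :=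
  fun i => SignType.sign (form b i u - r i)

theorem sign_sub_eq_iff {x y c : ℝ} :
    SignType.sign (x - c) = SignType.sign (y - c) ↔ ((x < c ↔ y < c) ∧ (x = c ↔ y = c)) := by
  constructor
  · intro h
    refine ⟨?_, ?_⟩
    · rw [← sub_neg, ← sign_eq_neg_one_iff, h, sign_eq_neg_one_iff, sub_neg]
    · rw [← sub_eq_zero, ← sign_eq_zero_iff, h, sign_eq_zero_iff, sub_eq_zero]
  · rintro ⟨h1, h2⟩
    rcases lt_trichotomy x c with h | h | h
    · rw [sign_neg (sub_neg.2 h), sign_neg (sub_neg.2 (h1.1 h))]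
    · rw [h, h2.1 h]
    · have hy : c < y := lt_of_le_of_ne (not_lt.1 fun hy => h.not_gt (h1.2 hy))
        fun hy => h.ne' (h2.2 hy.symm)
      rw [sign_pos (sub_pos.2 h), sign_pos (sub_pos.2 hy)]

theorem cellOf_eq_signCell {F : Finset (Fin n)} {u : Fin d → ℝ} (hu : u ∈ flat d n b r F) :
    cellOf d n b r F u = signCell (form b) r (signVec b r u) := by
  ext v
  constructor
  · rintro ⟨hv, h⟩ i
    by_cases hi : toR d (b i) ∈ spanF d n b F
    · rw [signVec, form_eq_of_mem_span hi hu hv]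
    · rw [signVec, sign_sub_eq_iff, form_apply, form_apply]
      exact h i hi
  · intro h
    refine ⟨mem_flat.2 fun i hi => ?_, fun i _ => ?_⟩
    · have := (sign_sub_eq_iff.1 (h i)).2
      exact this.2 (mem_flat.1 hu i hi)
    · have := sign_sub_eq_iff.1 (h i)
      rw [form_apply, form_apply] at this
      exact this

/-- The sign vectors of the nonempty bounded cells. -/
def boundedSigns (b : Fin n → Fin d → ℤ) (r : Fin n → ℝ) : Finset (Fin n → SignType) :=
  Finset.univ.filter fun s =>
    (signCell (form b) r s).Nonempty ∧ Bornology.IsBounded (signCell (form b) r s)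

theorem mem_boundedSigns {s : Fin n → SignType} : s ∈ boundedSigns b r ↔
    (signCell (form b) r s).Nonempty ∧ Bornology.IsBounded (signCell (form b) r s) := by
  simp [boundedSigns]

theorem signVec_eq {s : Fin n → SignType} {u : Fin d → ℝ} (hu : u ∈ signCell (form b) r s) :
    signVec b r u = s := funext hu

theorem fBd_eq_card (hr : Simple d n b r) (F : Finset (Fin n)) (k : ℕ) :
    fBd d n b r F k =
      ((boundedSigns b r).filter fun s => F ⊆ zeroSet s ∧ d - (zeroSet s).card = k).card := by
  rw [fBd, ← Nat.card_eq_finsetCard]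
  symm
  refine Nat.card_congr (Equiv.ofBijective
    (fun s => ⟨signCell (form b) r s.1, ?_⟩) ⟨?_, ?_⟩)
  · obtain ⟨s, hs⟩ := s
    obtain ⟨hs, hF, hk⟩ := Finset.mem_filter.1 hs
    obtain ⟨hne, hbd⟩ := mem_boundedSigns.1 hs
    have hdim := finrank_direction_signFlat hr hne
    refine ⟨?_, hbd, ?_⟩
    · obtain ⟨u, hu⟩ := hne
      have huF : u ∈ flat d n b r F := mem_flat.2 fun i hi =>
        mem_flat.1 (signCell_subset_flat s hu) i (hF hi)
      exact ⟨u, huF, by rw [cellOf_eq_signCell huF, signVec_eq hu]⟩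
    · rw [vectorSpan_signCell hne]
      omega
  · rintro ⟨s, hs⟩ ⟨t, ht⟩ h
    obtain ⟨u, hu⟩ := (mem_boundedSigns.1 (Finset.mem_filter.1 hs).1).1
    have h : signCell (form b) r s = signCell (form b) r t := congrArg Subtype.val h
    have hut : u ∈ signCell (form b) r t := h ▸ hu
    exact Subtype.ext ((signVec_eq hu).symm.trans (signVec_eq hut))
  · rintro ⟨C, ⟨u, hu, rfl⟩, hbd, hk⟩
    rw [cellOf_eq_signCell hu] at hbd hk
    have hmem : u ∈ signCell (form b) r (signVec b r u) := fun i => rfl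
    have hdim := finrank_direction_signFlat hr ⟨u, hmem⟩
    rw [vectorSpan_signCell ⟨u, hmem⟩] at hk
    refine ⟨⟨signVec b r u, Finset.mem_filter.2 ⟨mem_boundedSigns.2 ⟨⟨u, hmem⟩, hbd⟩,
      fun i hi => ?_, by omega⟩⟩, Subtype.ext (cellOf_eq_signCell hu).symm⟩
    rw [mem_zeroSet, signVec, mem_flat.1 hu i hi, sub_self, sign_zero]

theorem hBdPoly_eq_sum (hr : Simple d n b r) {F : Finset (Fin n)} (hF : memMatroid d n b F) :
    hBdPoly d n b r F =
      ∑ s ∈ (boundedSigns b r).filter fun s => F ⊆ zeroSet s,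
        (X - 1 : Polynomial ℤ) ^ (d - (zeroSet s).card) := by
  rw [hBdPoly, ← Finset.sum_fiberwise_of_maps_to (g := fun s => d - (zeroSet s).card)
    (t := Finset.range (d - dimF d n b F + 1))]
  · refine Finset.sum_congr rfl fun k _ => ?_
    rw [fBd_eq_card hr, Finset.sum_congr rfl fun s hs => by
      rw [(Finset.mem_filter.1 hs).2], Finset.sum_const, Finset.filter_filter]
    simp
  · intro s hs
    have := Finset.card_le_card (Finset.mem_filter.1 hs).2
    rw [dimF_eq_card hF, Finset.mem_range]
    omega

end SimpleArrangement

section TileCount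

variable {d n : ℕ} {b : Fin n → Fin d → ℤ}

theorem toR_injective : Function.Injective (toR d) := fun x y h => by
  funext j
  have hj : (x j : ℝ) = y j := congrFun h j
  exact_mod_cast hj

theorem toR_add (x y : Fin d → ℤ) : toR d (x + y) = toR d x + toR d y := by
  funext j; simp [toR]

theorem toR_sub (x y : Fin d → ℤ) : toR d (x - y) = toR d x - toR d y := by
  funext j; simp [toR]

theorem comb_intCast (k : Fin n → ℤ) :
    comb b (fun i => (k i : ℝ)) = toR d (∑ i, k i • b i) := by
  funext j
  simp [comb_apply_apply, toR]

theorem finite_lattice_of_isBounded {A : Set (Fin d → ℝ)} (hA : Bornology.IsBounded A) :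
    {z : Fin d → ℤ | toR d z ∈ A}.Finite := by
  obtain ⟨R, hR⟩ := hA.subset_closedBall 0
  refine (Set.finite_Icc (fun _ => -⌈R⌉ : Fin d → ℤ) (fun _ => ⌈R⌉)).subset fun z hz => ?_
  have h1 : ∀ j, |(z j : ℝ)| ≤ R := fun j => by
    have h2 := hR hz
    rw [mem_closedBall_zero_iff] at h2
    exact (norm_le_pi_norm (toR d z) j).trans h2
  refine ⟨fun j => ?_, fun j => ?_⟩
  · have h2 := (abs_le.1 (h1 j)).1
    have h3 : -((⌈R⌉ : ℤ) : ℝ) ≤ z j := by linarith [Int.le_ceil R]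
    exact_mod_cast h3
  · have h2 := (abs_le.1 (h1 j)).2
    have h3 : (z j : ℝ) ≤ (⌈R⌉ : ℤ) := by linarith [Int.le_ceil R]
    exact_mod_cast h3

theorem isBounded_zonotope (a : Fin n → ℝ) : Bornology.IsBounded (zonotope b a) := by
  have h : IsCompact (comb b '' Set.Icc 0 a) :=
    isCompact_Icc.image (comb b).continuous_of_finiteDimensional
  refine h.isBounded.subset ?_
  rintro z ⟨c, hc, rfl⟩
  exact ⟨c, ⟨fun i => (hc i).1, fun i => (hc i).2⟩, rfl⟩

theorem eq_zero_of_comb_eq_zero {F : Finset (Fin n)} (hF : memMatroid d n b F) {c : Fin n → ℝ}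
    (hc : ∀ i ∉ F, c i = 0) (h : comb b c = 0) : c = 0 := by
  have h1 : ∑ i : F, c i.1 • toR d (b i.1) = 0 := by
    rw [comb_apply, ← Finset.sum_subset (Finset.subset_univ F) fun i _ hi => by
      rw [hc i hi, zero_smul]] at h
    rw [Finset.sum_coe_sort F fun i => c i • toR d (b i)]
    exact h
  have h2 := Fintype.linearIndependent_iff.1 hF (fun i => c i.1) h1
  funext i
  by_cases hi : i ∈ F
  · exact h2 ⟨i, hi⟩
  · exact hc i hi

/-- The coefficient vectors in `S` representing lattice points. -/
def latticeCoeff (b : Fin n → Fin d → ℤ) (S : Set (Fin n → ℝ)) : Set (Fin n → ℝ) :=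
  {c ∈ S | ∃ z, toR d z = comb b c}

theorem image_latticeCoeff (S : Set (Fin n → ℝ)) :
    comb b '' latticeCoeff b S = toR d '' {z | toR d z ∈ comb b '' S} := by
  ext x
  constructor
  · rintro ⟨c, ⟨hc, z, hz⟩, rfl⟩
    exact ⟨z, ⟨c, hc, hz.symm⟩, hz⟩
  · rintro ⟨z, ⟨c, hc, hz⟩, rfl⟩
    exact ⟨c, ⟨hc, z, hz.symm⟩, hz⟩

theorem finite_latticeCoeff {S : Set (Fin n → ℝ)} (hinj : Set.InjOn (comb b) S)
    (hS : Bornology.IsBounded (comb b '' S)) : (latticeCoeff b S).Finite := by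
  refine Set.Finite.of_finite_image ?_ (hinj.mono fun c hc => hc.1)
  rw [image_latticeCoeff]
  exact (finite_lattice_of_isBounded hS).image _

theorem ncard_latticeCoeff {S : Set (Fin n → ℝ)} (hinj : Set.InjOn (comb b) S) :
    (latticeCoeff b S).ncard = Nat.card {z : Fin d → ℤ | toR d z ∈ comb b '' S} := by
  rw [← (hinj.mono fun c hc => hc.1 : Set.InjOn (comb b) (latticeCoeff b S)).ncard_image,
    image_latticeCoeff, Set.ncard_image_of_injective _ toR_injective]
  rfl

/-- The coefficient vectors of a tile. -/
def tileCoeff (s : Fin n → SignType) (a : Fin n → ℝ) : Set (Fin n → ℝ) :=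
  {c | (∀ i, 0 ≤ c i ∧ c i ≤ a i) ∧ (∀ i, s i = -1 → c i = 0) ∧ ∀ i, s i = 1 → c i = a i}

theorem image_tileCoeff (s : Fin n → SignType) (a : Fin n → ℝ) :
    comb b '' tileCoeff s a = tile b s a := by
  ext z
  simp [tileCoeff, tile, and_assoc]

theorem injOn_tileCoeff {s : Fin n → SignType} (hs : memMatroid d n b (zeroSet s))
    (a : Fin n → ℝ) : Set.InjOn (comb b) (tileCoeff s a) := by
  rintro c ⟨-, h1, h2⟩ c' ⟨-, h1', h2'⟩ h
  refine sub_eq_zero.1 (eq_zero_of_comb_eq_zero hs (fun i hi => ?_) ?_)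
  · rw [mem_zeroSet] at hi
    rw [Pi.sub_apply]
    rcases hsi : s i with _ | _ | _
    · exact absurd hsi hi
    · rw [h1 i hsi, h1' i hsi, sub_zero]
    · rw [h2 i hsi, h2' i hsi, sub_self]
  · rw [map_sub, h, sub_self]

/-- The coefficient vectors of `BOX(F)`. -/
def boxCoeff (F : Finset (Fin n)) : Set (Fin n → ℝ) :=
  {α | (∀ i ∈ F, 0 < α i ∧ α i < 1) ∧ ∀ i ∉ F, α i = 0}

theorem image_boxCoeff (F : Finset (Fin n)) : comb b '' boxCoeff F = box d n b F := by
  ext x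
  constructor
  · rintro ⟨α, ⟨h1, h2⟩, rfl⟩
    refine ⟨α, h1, ?_⟩
    rw [comb_apply]
    refine (Finset.sum_subset (Finset.subset_univ F) fun i _ hi => ?_).symm
    rw [h2 i hi, zero_smul]
  · rintro ⟨α, h1, rfl⟩
    refine ⟨fun i => if i ∈ F then α i else 0,
      ⟨fun i hi => by simpa [hi] using h1 i hi, fun i hi => by simp [hi]⟩, ?_⟩
    rw [comb_apply]
    simp

theorem injOn_boxCoeff {F : Finset (Fin n)} (hF : memMatroid d n b F) :
    Set.InjOn (comb b) (boxCoeff F) := by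
  rintro c ⟨-, h⟩ c' ⟨-, h'⟩ hcc
  refine sub_eq_zero.1 (eq_zero_of_comb_eq_zero hF (fun i hi => ?_) ?_)
  · rw [Pi.sub_apply, h i hi, h' i hi, sub_zero]
  · rw [map_sub, hcc, sub_self]

theorem finite_latticeCoeff_box {F : Finset (Fin n)} (hF : memMatroid d n b F) :
    (latticeCoeff b (boxCoeff F)).Finite := by
  refine finite_latticeCoeff (injOn_boxCoeff hF)
    ((isBounded_zonotope (b := b) fun _ => 1).subset ?_)
  rintro _ ⟨α, ⟨h1, h2⟩, rfl⟩
  refine ⟨α, fun i => ?_, rfl⟩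
  by_cases hi : i ∈ F
  · exact ⟨(h1 i hi).1.le, (h1 i hi).2.le⟩
  · rw [h2 i hi]; simp

theorem finite_latticeCoeff_tile {s : Fin n → SignType} (hs : memMatroid d n b (zeroSet s))
    (a : Fin n → ℝ) : (latticeCoeff b (tileCoeff s a)).Finite := by
  refine finite_latticeCoeff (injOn_tileCoeff hs a) ((isBounded_zonotope (b := b) a).subset ?_)
  rw [image_tileCoeff]
  exact tile_subset_zonotope b s a

/-- The integer parts allowed for the `i`-th coefficient of a point of a tile, when the
coefficients with nonzero fractional part are those indexed by `F`. -/
def floorSet (s : Fin n → SignType) (F : Finset (Fin n)) (a : Fin n → ℕ) (i : Fin n) : Finset ℕ :=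
  if s i = 0 then (if i ∈ F then Finset.range (a i) else Finset.range (a i + 1))
  else if s i = 1 then {a i} else {0}

/-- The lattice points of a tile decompose into translates of lattice points of boxes. -/
theorem card_tile {s : Fin n → SignType} (hs : memMatroid d n b (zeroSet s)) (a : Fin n → ℕ) :
    Nat.card {z : Fin d → ℤ | toR d z ∈ tile b s fun i => (a i : ℝ)} =
      ∑ F ∈ (zeroSet s).powerset, boxCount d n b F * ∏ i, (floorSet s F a i).card := by
  have hbox : ∀ F ∈ (zeroSet s).powerset, (latticeCoeff b (boxCoeff F)).Finite := fun F hF =>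
    finite_latticeCoeff_box (memMatroid_mono (Finset.mem_powerset.1 hF) hs)
  set B : Finset (Fin n) → Finset (Fin n → ℝ) := fun F =>
    if h : F ∈ (zeroSet s).powerset then (hbox F h).toFinset else ∅ with hB
  have memB : ∀ F ∈ (zeroSet s).powerset, ∀ α, α ∈ B F ↔ α ∈ latticeCoeff b (boxCoeff F) := by
    intro F hF α
    simp only [hB, dif_pos hF, Set.Finite.mem_toFinset]
  have cardB : ∀ F ∈ (zeroSet s).powerset, boxCount d n b F = (B F).card := by
    intro F hF
    rw [boxCount, ← image_boxCoeff, ← ncard_latticeCoeff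
      (injOn_boxCoeff (memMatroid_mono (Finset.mem_powerset.1 hF) hs)),
      Set.ncard_eq_toFinset_card _ (hbox F hF)]
    simp only [hB, dif_pos hF]
  have hcard : ∑ F ∈ (zeroSet s).powerset, boxCount d n b F * ∏ i, (floorSet s F a i).card =
      ((zeroSet s).powerset.sigma fun F => B F ×ˢ Fintype.piFinset (floorSet s F a)).card := by
    rw [Finset.card_sigma]
    refine Finset.sum_congr rfl fun F hF => ?_
    rw [cardB F hF, Finset.card_product, Fintype.card_piFinset]
  have hfin := finite_latticeCoeff_tile (b := b) hs fun i => (a i : ℝ)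
  rw [hcard, ← image_tileCoeff, ← ncard_latticeCoeff (injOn_tileCoeff hs _),
    Set.ncard_eq_toFinset_card _ hfin]
  refine Finset.card_bij'
    (fun c _ => ⟨Finset.univ.filter fun i => Int.fract (c i) ≠ 0,
      (fun i => Int.fract (c i), fun i => ⌊c i⌋₊)⟩)
    (fun p _ => fun i => p.2.1 i + (p.2.2 i : ℝ)) ?_ ?_ ?_ ?_
  · intro c hc
    obtain ⟨⟨h1, h2, h3⟩, z, hz⟩ := hfin.mem_toFinset.1 hc
    have hF : (Finset.univ.filter fun i => Int.fract (c i) ≠ 0) ∈ (zeroSet s).powerset := by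
      rw [Finset.mem_powerset]
      intro i hi
      rw [mem_zeroSet]
      by_contra hne
      refine (Finset.mem_filter.1 hi).2 ?_
      rcases hsi : s i with _ | _ | _
      · exact absurd hsi hne
      · rw [h2 i hsi, Int.fract_zero]
      · rw [h3 i hsi, Int.fract_natCast]
    rw [Finset.mem_sigma, Finset.mem_product]
    refine ⟨hF, ?_, ?_⟩
    · rw [memB _ hF]
      refine ⟨⟨fun i hi => ?_, fun i hi => ?_⟩, z - ∑ i, ⌊c i⌋ • b i, ?_⟩
      · exact ⟨lt_of_le_of_ne (Int.fract_nonneg _) (Ne.symm (Finset.mem_filter.1 hi).2),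
          Int.fract_lt_one _⟩
      · simpa using hi
      · rw [toR_sub, hz, ← comb_intCast, ← map_sub]
        rfl
    · rw [Fintype.mem_piFinset]
      intro i
      rw [floorSet]
      split_ifs with h4 h5 h6
      · rw [Finset.mem_range, Nat.floor_lt (h1 i).1]
        refine lt_of_le_of_ne (h1 i).2 fun h => (Finset.mem_filter.1 h5).2 ?_
        rw [h, Int.fract_natCast]
      · rw [Finset.mem_range, Nat.lt_succ_iff]
        exact Nat.floor_le_of_le (h1 i).2
      · simp [h3 i h6]
      · have : s i = -1 := by
          rcases hsi : s i with _ | _ | _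
          · exact absurd hsi h4
          · rfl
          · exact absurd hsi h6
        simp [h2 i this]
  · rintro ⟨F, α, k⟩ hp
    obtain ⟨hF, hp⟩ := Finset.mem_sigma.1 hp
    obtain ⟨hα, hk⟩ := Finset.mem_product.1 hp
    obtain ⟨⟨h1, h2⟩, z, hz⟩ := (memB F hF α).1 hα
    rw [Fintype.mem_piFinset] at hk
    have hsF : ∀ i, s i ≠ 0 → α i = 0 := fun i hi => h2 i fun hiF =>
      hi (mem_zeroSet.1 (Finset.mem_powerset.1 hF hiF))
    rw [hfin.mem_toFinset]
    refine ⟨⟨fun i => ?_, fun i hi => ?_, fun i hi => ?_⟩, z + ∑ i, (k i : ℤ) • b i, ?_⟩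
    · have hki := hk i
      simp only [floorSet] at hki
      split_ifs at hki with h4 h5 h6
      · obtain ⟨p1, p2⟩ := h1 i h5
        have : (k i : ℝ) + 1 ≤ a i := by exact_mod_cast Finset.mem_range.1 hki
        have h0 : (0 : ℝ) ≤ k i := Nat.cast_nonneg _
        exact ⟨by simp only; linarith, by simp only; linarith⟩
      · have : (k i : ℝ) ≤ a i := by exact_mod_cast Nat.lt_succ_iff.1 (Finset.mem_range.1 hki)
        simpa [h2 i h5] using this
      · simp [hsF i h4, Finset.mem_singleton.1 hki]
      · simp [hsF i h4, Finset.mem_singleton.1 hki]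
    · have hki := hk i
      simp only [floorSet, hi] at hki
      have : k i = 0 := by simpa using hki
      simp [this, hsF i (by rw [hi]; decide)]
    · have hki := hk i
      simp only [floorSet, hi] at hki
      have : k i = a i := by simpa using hki
      simp [this, hsF i (by rw [hi]; decide)]
    · rw [toR_add, hz, ← comb_intCast, ← map_add]
      congr 1
  · intro c hc
    obtain ⟨⟨h1, -, -⟩, -⟩ := hfin.mem_toFinset.1 hc
    funext i
    have := natCast_floor_eq_intCast_floor (R := ℝ) (h1 i).1
    simp only [this]
    exact Int.fract_add_floor (c i)
  · rintro ⟨F, α, k⟩ hp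
    obtain ⟨hF, hp⟩ := Finset.mem_sigma.1 hp
    obtain ⟨hα, hk⟩ := Finset.mem_product.1 hp
    obtain ⟨⟨h1, h2⟩, -⟩ := (memB F hF α).1 hα
    have h01 : ∀ i, 0 ≤ α i ∧ α i < 1 := fun i => by
      by_cases hi : i ∈ F
      · exact ⟨(h1 i hi).1.le, (h1 i hi).2⟩
      · rw [h2 i hi]; simp
    have hfr : ∀ i, Int.fract (α i + (k i : ℝ)) = α i := fun i => by
      rw [Int.fract_add_natCast, Int.fract_eq_self.2 (h01 i)]
    have hfl : ∀ i, ⌊α i + (k i : ℝ)⌋₊ = k i := fun i => by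
      rw [Nat.floor_add_natCast (h01 i).1, Nat.floor_eq_zero.2 (h01 i).2, zero_add]
    have hFF : (Finset.univ.filter fun i => α i ≠ 0) = F := by
      ext i
      simp only [Finset.mem_filter, Finset.mem_univ, true_and]
      refine ⟨fun h => by_contra fun hi => h (h2 i hi), fun hi => (h1 i hi).1.ne'⟩
    simp only [hfr, hfl, hFF]

end TileCount

section Series

variable {d n : ℕ} {b : Fin n → Fin d → ℤ}

/-- The number of integer parts allowed for the `i`-th coefficient. -/
def floorWeight (s : Fin n → SignType) (F : Finset (Fin n)) (i : Fin n) (k : ℕ) : ℤ :=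
  if s i = 0 then (if i ∈ F then (k : ℤ) else k + 1) else 1

theorem card_floorSet (s : Fin n → SignType) (F : Finset (Fin n)) (a : Fin n → ℕ) (i : Fin n) :
    ((floorSet s F a i).card : ℤ) = floorWeight s F i (a i) := by
  unfold floorSet floorWeight
  split_ifs <;> simp

theorem mk_natCast_add_one_mul :
    (PowerSeries.mk fun k => (k : ℤ) + 1) * (1 - PowerSeries.X) ^ 2 = 1 := by
  have h : (PowerSeries.mk fun k => (k : ℤ) + 1) * (1 - PowerSeries.X) = PowerSeries.mk 1 := by
    ext k
    rw [mul_sub, mul_one, map_sub]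
    cases k with
    | zero => simp
    | succ k => rw [PowerSeries.coeff_succ_mul_X]; simp
  rw [pow_two, ← mul_assoc, h]
  exact PowerSeries.mk_one_mul_one_sub_eq_one ℤ

theorem mk_natCast_mul :
    (PowerSeries.mk fun k => (k : ℤ)) * (1 - PowerSeries.X) ^ 2 = PowerSeries.X := by
  have h : (PowerSeries.mk fun k => (k : ℤ)) =
      (PowerSeries.mk fun k => (k : ℤ) + 1) * PowerSeries.X := by
    ext k
    cases k with
    | zero => simp
    | succ k => rw [PowerSeries.coeff_succ_mul_X]; simp
  rw [h, mul_right_comm, mk_natCast_add_one_mul, one_mul]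

theorem mk_floorWeight (s : Fin n → SignType) (F : Finset (Fin n)) (i : Fin n)
    (hF : F ⊆ zeroSet s) :
    PowerSeries.mk (floorWeight s F i) * (1 - PowerSeries.X) ^ (if s i = 0 then 2 else 1) =
      if i ∈ F then PowerSeries.X else 1 := by
  unfold floorWeight
  by_cases h : s i = 0
  · by_cases h' : i ∈ F
    · simp only [h, h', if_true]
      exact mk_natCast_mul
    · simp only [h, h', if_true, if_false]
      exact mk_natCast_add_one_mul
  · have h' : i ∉ F := fun hi => h (mem_zeroSet.1 (hF hi))
    simp only [h, h', if_false, pow_one]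
    exact PowerSeries.mk_one_mul_one_sub_eq_one ℤ

theorem one_sub_pow_mul_series (s : Fin n → SignType) (F : Finset (Fin n)) (hF : F ⊆ zeroSet s) :
    (1 - PowerSeries.X) ^ (n + (zeroSet s).card) *
      PowerSeries.mk (fun m => ∑ a ∈ Finset.finsuppAntidiag Finset.univ m,
        ∏ i, ((floorSet s F a i).card : ℤ)) = PowerSeries.X ^ F.card := by
  have h1 : PowerSeries.mk (fun m => ∑ a ∈ Finset.finsuppAntidiag Finset.univ m,
      ∏ i, ((floorSet s F a i).card : ℤ)) =
      ∏ i, PowerSeries.mk (floorWeight s F i) := by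
    ext m
    rw [PowerSeries.coeff_mk, PowerSeries.coeff_prod]
    simp only [PowerSeries.coeff_mk, card_floorSet]
  have h2 : n + (zeroSet s).card = ∑ i, if s i = 0 then 2 else 1 := by
    have : ∀ i, (if s i = 0 then 2 else 1) = 1 + if s i = 0 then 1 else 0 := fun i => by
      split_ifs <;> rfl
    simp only [this, Finset.sum_add_distrib]
    simp [zeroSet]
  rw [h1, h2, ← Finset.prod_pow_eq_pow_sum, mul_comm, ← Finset.prod_mul_distrib,
    Finset.prod_congr rfl fun i _ => mk_floorWeight s F i hF, Finset.prod_ite_mem]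
  simp

/-- The lattice points of a zonotope, counted through the tiles of the bounded cells. -/
theorem card_zonotope (hgen : Submodule.span ℤ (Set.range b) = ⊤) {r : Fin n → ℝ}
    (hr : Simple d n b r) (a : Fin n → ℕ) :
    (Nat.card {z : Fin d → ℤ | toR d z ∈ zonotope b fun i => (a i : ℝ)} : ℤ) =
      ∑ s ∈ boundedSigns b r, (-1) ^ (d - (zeroSet s).card) *
        ∑ F ∈ (zeroSet s).powerset, (boxCount d n b F : ℤ) *
          ∏ i, ((floorSet s F a i).card : ℤ) := by
  have hfin := finite_lattice_of_isBounded (isBounded_zonotope (b := b) fun i => (a i : ℝ))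
  set T := hfin.toFinset with hT
  have h1 : Nat.card {z : Fin d → ℤ | toR d z ∈ zonotope b fun i => (a i : ℝ)} = T.card := by
    rw [hT, ← Set.ncard_eq_toFinset_card _ hfin]
    rfl
  have h2 : ∀ z ∈ T, ∑ s ∈ boundedSigns b r,
      (if toR d z ∈ tile b s fun i => (a i : ℝ) then (-1 : ℤ) ^ (d - (zeroSet s).card) else 0) =
      1 := by
    intro z hz
    rw [hT, Set.Finite.mem_toFinset] at hz
    refine Eq.trans ?_ (sum_tiles hgen r hz)
    rw [boundedSigns, Finset.sum_filter]
    refine Finset.sum_congr rfl fun s _ => ?_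
    by_cases hs : (signCell (form b) r s).Nonempty
    · have : d - (zeroSet s).card = finrank ℝ (signFlat (form b) r s).direction := by
        have := finrank_direction_signFlat hr hs
        omega
      rw [this, ← ite_and]
      simp only [and_assoc]
    · simp [hs]
  rw [h1, Finset.card_eq_sum_ones, Nat.cast_sum, Nat.cast_one, ← Finset.sum_congr rfl h2,
    Finset.sum_comm]
  refine Finset.sum_congr rfl fun s hs => ?_
  have hZ := memMatroid_zeroSet hr (mem_boundedSigns.1 hs).1
  have h3 := card_tile hZ a
  have h4 : Nat.card {z : Fin d → ℤ | toR d z ∈ tile b s fun i => (a i : ℝ)} =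
      (T.filter fun z => toR d z ∈ tile b s fun i => (a i : ℝ)).card := by
    rw [← Nat.card_eq_finsetCard]
    refine Nat.card_congr (Equiv.subtypeEquivRight fun z => ?_)
    rw [Finset.mem_filter, hT, Set.Finite.mem_toFinset]
    exact ⟨fun h => ⟨tile_subset_zonotope b s _ h, h⟩, fun h => h.2⟩
  rw [← Finset.sum_filter, Finset.sum_const, ← h4, h3, nsmul_eq_mul, mul_comm]
  push_cast
  rfl

end Series

section Lawrence

variable {d n : ℕ} {b : Fin n → Fin d → ℤ}

/-- A description of the dilates of the Lawrence polytope by zonotopes. -/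
def zonotopeFamily (b : Fin n → Fin d → ℤ) (m : ℝ) : Set ((Fin d → ℝ) × (Fin n → ℝ)) :=
  {p | (∀ i, 0 ≤ p.2 i) ∧ ∑ i, p.2 i = m ∧ p.1 ∈ zonotope b p.2}

theorem comb_single (i : Fin n) (t : ℝ) : comb b (Pi.single i t) = t • toR d (b i) := by
  rw [comb_apply, Finset.sum_eq_single i]
  · simp
  · intro k _ hk
    simp [hk]
  · simp

theorem convex_zonotopeFamily : Convex ℝ (zonotopeFamily b 1) := by
  rintro ⟨x, y⟩ ⟨hy, hys, c, hc, hcx⟩ ⟨x', y'⟩ ⟨hy', hys', c', hc', hcx'⟩ t t' ht ht' htt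
  simp only at hy hys hc hcx hy' hys' hc' hcx'
  refine ⟨fun i => ?_, ?_, t • c + t' • c', fun i => ⟨?_, ?_⟩, ?_⟩
  · exact add_nonneg (mul_nonneg ht (hy i)) (mul_nonneg ht' (hy' i))
  · simp only [Prod.snd_add, Prod.smul_snd, Pi.add_apply, Pi.smul_apply, smul_eq_mul,
      Finset.sum_add_distrib, ← Finset.mul_sum, hys, hys', mul_one, htt]
  · exact add_nonneg (mul_nonneg ht (hc i).1) (mul_nonneg ht' (hc' i).1)
  · exact add_le_add (mul_le_mul_of_nonneg_left (hc i).2 ht)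
      (mul_le_mul_of_nonneg_left (hc' i).2 ht')
  · rw [map_add, map_smul, map_smul, hcx, hcx']
    rfl

theorem lawrencePolytope_subset : lawrencePolytope d n b ⊆ zonotopeFamily b 1 := by
  have he0 : ∀ i k, 0 ≤ e n i k := fun i k => by
    unfold e
    rw [Pi.single_apply]; split_ifs <;> norm_num
  have he1 : ∀ i, ∑ k, e n i k = 1 := fun i => by simp [e]
  refine convexHull_min ?_ convex_zonotopeFamily
  rintro p (⟨i, rfl⟩ | ⟨i, rfl⟩)
  · refine ⟨he0 i, he1 i, e n i, fun k => ⟨he0 i k, le_rfl⟩, ?_⟩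
    rw [e, comb_single, one_smul]
  · exact ⟨he0 i, he1 i, 0, fun k => ⟨le_rfl, he0 i k⟩, map_zero _⟩

theorem smul_lawrencePolytope (hn : 0 < n) (m : ℕ) :
    (m : ℝ) • lawrencePolytope d n b = zonotopeFamily b m := by
  have hm0 : (0 : ℝ) ≤ m := Nat.cast_nonneg m
  apply Set.Subset.antisymm
  · rintro _ ⟨p, hp, rfl⟩
    obtain ⟨hy, hys, c, hc, hcx⟩ := lawrencePolytope_subset hp
    refine ⟨fun i => mul_nonneg hm0 (hy i), ?_, (m : ℝ) • c, fun i => ⟨?_, ?_⟩, ?_⟩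
    · simp only [Prod.smul_snd, Pi.smul_apply, smul_eq_mul, ← Finset.mul_sum, hys, mul_one]
    · exact mul_nonneg hm0 (hc i).1
    · exact mul_le_mul_of_nonneg_left (hc i).2 hm0
    · rw [map_smul, hcx]; rfl
  · rintro ⟨x, y⟩ ⟨hy, hys, c, hc, hcx⟩
    simp only at hy hys hc hcx
    rcases hm0.eq_or_lt with hm | hm
    · rw [← hm] at hys ⊢
      have hy0 : y = 0 := by
        funext i
        exact (Finset.sum_eq_zero_iff_of_nonneg fun i _ => hy i).1 hys i (Finset.mem_univ i)
      have hc0 : c = 0 := by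
        funext i
        have h1 := hc i
        rw [hy0] at h1
        exact le_antisymm h1.2 h1.1
      refine ⟨((0 : Fin d → ℝ), e n ⟨0, hn⟩), subset_convexHull ℝ _ (Or.inr ⟨⟨0, hn⟩, rfl⟩), ?_⟩
      rw [← hcx, hc0, hy0, map_zero]
      exact zero_smul ℝ _
    · refine ⟨(m : ℝ)⁻¹ • (x, y), ?_, smul_inv_smul₀ hm.ne' _⟩
      have hdec : (m : ℝ)⁻¹ • (x, y) = ∑ k : Fin n ⊕ Fin n,
          Sum.elim (fun i => (m : ℝ)⁻¹ * c i) (fun i => (m : ℝ)⁻¹ * (y i - c i)) k •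
          Sum.elim (fun i => (toR d (b i), e n i)) (fun i => ((0 : Fin d → ℝ), e n i)) k := by
        rw [Fintype.sum_sum_type]
        simp only [Sum.elim_inl, Sum.elim_inr]
        refine Prod.ext ?_ ?_
        · simp only [Prod.smul_fst, Prod.fst_add, Prod.fst_sum, smul_zero, Finset.sum_const_zero,
            add_zero, mul_smul, ← Finset.smul_sum]
          rw [← comb_apply, hcx]
        · simp only [Prod.smul_snd, Prod.snd_add, Prod.snd_sum, ← Finset.sum_add_distrib,
            ← add_smul]
          funext k
          simp [e, Pi.single_apply]
          ring
      rw [hdec]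
      refine (convex_convexHull ℝ _).sum_mem ?_ ?_ ?_
      · rintro (i | i) -
        · exact mul_nonneg (inv_nonneg.2 hm0) (hc i).1
        · exact mul_nonneg (inv_nonneg.2 hm0) (sub_nonneg.2 (hc i).2)
      · rw [Fintype.sum_sum_type]
        simp only [Sum.elim_inl, Sum.elim_inr, ← Finset.mul_sum, Finset.sum_sub_distrib, hys]
        rw [mul_sub, add_sub_cancel, inv_mul_cancel₀ hm.ne']
      · rintro (i | i) -
        · exact subset_convexHull ℝ _ (Or.inl ⟨i, rfl⟩)
        · exact subset_convexHull ℝ _ (Or.inr ⟨i, rfl⟩)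

theorem latticeCount_eq (hn : 0 < n) (m : ℕ) :
    latticeCount d n (lawrencePolytope d n b) m =
      ∑ a ∈ Finset.finsuppAntidiag (Finset.univ : Finset (Fin n)) m,
        Nat.card {z : Fin d → ℤ | toR d z ∈ zonotope b fun i => (a i : ℝ)} := by
  have hfin : ∀ a : Fin n →₀ ℕ,
      Finite {z : Fin d → ℤ | toR d z ∈ zonotope b fun i => (a i : ℝ)} := fun a =>
    finite_lattice_of_isBounded (isBounded_zonotope _)
  rw [latticeCount, smul_lawrencePolytope hn, ← Finset.sum_coe_sort, ← Nat.card_sigma]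
  symm
  refine Nat.card_congr (Equiv.ofBijective
    (fun p => ⟨(p.2.1, fun i => ((p.1.1 i : ℕ) : ℤ)), ?_⟩) ⟨?_, ?_⟩)
  · obtain ⟨⟨a, ha⟩, z, hz⟩ := p
    have ha := (Finset.mem_finsuppAntidiag.1 ha).1
    refine ⟨fun i => by simp, ?_, by simpa using hz⟩
    have har : ∑ i, (a i : ℝ) = m := by exact_mod_cast ha
    simpa using har
  · rintro ⟨⟨a, ha⟩, z, hz⟩ ⟨⟨a', ha'⟩, z', hz'⟩ h
    have h1 : z = z' := congrArg (fun p => p.1.1) h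
    have h2 : (fun i => (a i : ℤ)) = fun i => (a' i : ℤ) := congrArg (fun p => p.1.2) h
    subst h1
    have : a = a' := by
      ext i
      exact_mod_cast congrFun h2 i
    subst this
    rfl
  · rintro ⟨⟨z, w⟩, hw, hws, hz⟩
    simp only at hw hws hz
    have hw0 : ∀ i, ((w i).toNat : ℤ) = w i := fun i => Int.toNat_of_nonneg (by exact_mod_cast hw i)
    have hwr : ∀ i, (((w i).toNat : ℕ) : ℝ) = w i := fun i => by exact_mod_cast hw0 i
    refine ⟨⟨⟨Finsupp.equivFunOnFinite.symm fun i => (w i).toNat, ?_⟩, z, ?_⟩, ?_⟩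
    · rw [Finset.mem_finsuppAntidiag]
      refine ⟨?_, Finset.subset_univ _⟩
      simp only [← hwr] at hws
      have : ∑ i, (w i).toNat = m := by exact_mod_cast hws
      simpa using this
    · simpa [hwr] using hz
    · refine Subtype.ext (Prod.ext rfl (funext fun i => ?_))
      simpa using hw i

end Lawrence

section DeltaPolynomial

variable {d n : ℕ} {b : Fin n → Fin d → ℤ} {r : Fin n → ℝ}

theorem sum_matroid_eq_sum_boundedSigns (hr : Simple d n b r) :
    (∑ F : Finset (Fin n), if memMatroid d n b F then
        C (boxCount d n b F : ℤ) * X ^ dimF d n b F * hBdPoly d n b r F else 0) =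
      ∑ s ∈ boundedSigns b r, ∑ F ∈ (zeroSet s).powerset,
        C (boxCount d n b F : ℤ) * X ^ F.card * (X - 1) ^ (d - (zeroSet s).card) := by
  have h1 : ∀ F : Finset (Fin n), (if memMatroid d n b F then
      C (boxCount d n b F : ℤ) * X ^ dimF d n b F * hBdPoly d n b r F else 0) =
      ∑ s ∈ boundedSigns b r, if F ∈ (zeroSet s).powerset then
        C (boxCount d n b F : ℤ) * X ^ F.card * (X - 1) ^ (d - (zeroSet s).card) else 0 := by
    intro F
    simp only [Finset.mem_powerset]
    split_ifs with hF
    · rw [hBdPoly_eq_sum hr hF, dimF_eq_card hF, Finset.mul_sum, Finset.sum_filter]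
    · refine (Finset.sum_eq_zero fun s hs => if_neg fun h => hF ?_).symm
      exact memMatroid_mono h (memMatroid_zeroSet hr (mem_boundedSigns.1 hs).1)
  rw [Finset.sum_congr rfl fun F _ => h1 F, Finset.sum_comm]
  refine Finset.sum_congr rfl fun s _ => ?_
  rw [Finset.sum_ite_mem, Finset.univ_inter]

theorem mk_latticeCount (hn : 0 < n) (hgen : Submodule.span ℤ (Set.range b) = ⊤)
    (hr : Simple d n b r) :
    PowerSeries.mk (fun m => (latticeCount d n (lawrencePolytope d n b) m : ℤ)) =
      ∑ s ∈ boundedSigns b r, ∑ F ∈ (zeroSet s).powerset,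
        PowerSeries.C ((-1) ^ (d - (zeroSet s).card) * (boxCount d n b F : ℤ)) *
          PowerSeries.mk (fun m => ∑ a ∈ Finset.finsuppAntidiag Finset.univ m,
            ∏ i, ((floorSet s F a i).card : ℤ)) := by
  ext m
  simp only [PowerSeries.coeff_mk, map_sum, PowerSeries.coeff_C_mul, latticeCount_eq hn]
  rw [Nat.cast_sum, Finset.sum_congr rfl fun (a : Fin n →₀ ℕ) _ =>
    card_zonotope hgen hr (a : Fin n → ℕ), Finset.sum_comm]
  refine Finset.sum_congr rfl fun s _ => ?_
  rw [← Finset.mul_sum, Finset.sum_comm, Finset.mul_sum]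
  refine Finset.sum_congr rfl fun F _ => ?_
  rw [← Finset.mul_sum, mul_assoc]

theorem one_sub_pow_mul_mk_latticeCount (hn : 0 < n)
    (hgen : Submodule.span ℤ (Set.range b) = ⊤) (hr : Simple d n b r) :
    (1 - PowerSeries.X) ^ (n + d) *
        PowerSeries.mk (fun m => (latticeCount d n (lawrencePolytope d n b) m : ℤ)) =
      ((∑ s ∈ boundedSigns b r, ∑ F ∈ (zeroSet s).powerset,
        C (boxCount d n b F : ℤ) * X ^ F.card * (X - 1) ^ (d - (zeroSet s).card) :
          Polynomial ℤ) : PowerSeries ℤ) := by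
  rw [mk_latticeCount hn hgen hr, Finset.mul_sum, ← Polynomial.coeToPowerSeries.ringHom_apply,
    map_sum]
  refine Finset.sum_congr rfl fun s hs => ?_
  rw [Finset.mul_sum, map_sum]
  refine Finset.sum_congr rfl fun F hF => ?_
  have hdim := finrank_direction_signFlat hr (mem_boundedSigns.1 hs).1
  have hexp : n + d = (d - (zeroSet s).card) + (n + (zeroSet s).card) := by omega
  have hneg : (PowerSeries.X - 1 : PowerSeries ℤ) = PowerSeries.C (-1) * (1 - PowerSeries.X) := by
    simp
  rw [Polynomial.coeToPowerSeries.ringHom_apply]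
  simp only [Polynomial.coe_mul, Polynomial.coe_pow, Polynomial.coe_sub, Polynomial.coe_X,
    Polynomial.coe_one, Polynomial.coe_C]
  rw [← one_sub_pow_mul_series s F (Finset.mem_powerset.1 hF), hneg, mul_pow, ← map_pow, map_mul]
  conv_lhs => rw [hexp, pow_add]
  ring

end DeltaPolynomial

end Proof

/-- `δ_B(t) = Σ_{F ∈ M_B} #(BOX(F) ∩ ℤ^d) t^{dim F} h^bd_F(t)`. -/
theorem statement1 (d n : ℕ) (hd : 0 < d) (hn : 0 < n)
    (b : Fin n → Fin d → ℤ) (hb : ∀ i, b i ≠ 0)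
    (hgen : Submodule.span ℤ (Set.range b) = ⊤)
    (r : Fin n → ℝ) (hr : Simple d n b r)
    (δ : Polynomial ℤ) (hδ : IsDeltaPoly d n (lawrencePolytope d n b) δ) :
    δ = ∑ F : Finset (Fin n),
      if memMatroid d n b F then
        C (boxCount d n b F : ℤ) * X ^ dimF d n b F * hBdPoly d n b r F
      else 0 := by
  rw [sum_matroid_eq_sum_boundedSigns hr]
  exact Polynomial.coe_injective ℤ
    (hδ.2.symm.trans (one_sub_pow_mul_mk_latticeCount hn hgen hr))

end LawrencePaper
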